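/- (L¹ convergence of the "joint+marginal" upper approximations) Let X = {x ∈ ℝⁿ : h̃_k(x) ≥ 0, k = 1,…,s₃} and U = {u ∈ ℝᵖ : ĥ_k(u) ≥ 0, k = 1,…,s₁} be nonempty compact basic semialgebraic sets, and suppose the quadratic module Q(h̃, ĥ) generated in ℝ[x, u] by the polynomials h̃_k(x) and ĥ_k(u) is Archimedean. Let φ be a finite Borel measure supported in X with φ(O) > 0 for every nonempty open set O ⊆ ℝⁿ contained in X. Let f ∈ ℝ[x, u] and F(x) = sup_{u ∈ U} f(x, u) for x ∈ X. For each d ∈ ℕ let 𝒫_d be the set of polynomials q ∈ ℝ[x] with deg q ≤ d such that q(x) − f(x, u) lies in the 2d-truncated quadratic module Q_{2d}(h̃, ĥ) (i.e., q − f = σ₀ + Σ_k σ_k h̃_k + Σ_k τ_k ĥ_k with σ's and τ's sums of squares and each summand of degree at most 2d), and let ρ_d = inf { ∫_X q dφ : q ∈ 𝒫_d }. Then every q ∈ 𝒫_d satisfies q(x) ≥ F(x) for all x ∈ X, and for any sequence (q_d) with q_d ∈ 𝒫_d and ∫_X q_d dφ ≤ ρ_d + 1/d for all sufficiently large d, one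 has ∫_X |q_d − F| dφ = ∫_X (q_d − F) dφ → 0 as d → ∞. -/

import Mathlib

open MvPolynomial MeasureTheory Filter

/-- A real multivariate polynomial (in variables indexed by `σ`) is a sum of
squares. -/
def IsSumOfSquares {σ : Type} (q : MvPolynomial σ ℝ) : Prop :=
  ∃ (r : ℕ) (h : Fin r → MvPolynomial σ ℝ), q = ∑ k, (h k) ^ 2

/-- Membership in the quadratic module in `ℝ[x, u]` generated by the
polynomials `h̃_k(x)` and `ĥ_k(u)`:
`f = σ₀ + Σ_k σ_k h̃_k + Σ_k τ_k ĥ_k` with sums-of-squares multipliers. -/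
def MemJointQM {n p s₁ s₃ : ℕ} (ht : Fin s₃ → MvPolynomial (Fin n) ℝ)
    (hh : Fin s₁ → MvPolynomial (Fin p) ℝ)
    (f : MvPolynomial (Fin n ⊕ Fin p) ℝ) : Prop :=
  ∃ (σ₀ : MvPolynomial (Fin n ⊕ Fin p) ℝ)
    (σ : Fin s₃ → MvPolynomial (Fin n ⊕ Fin p) ℝ)
    (τ : Fin s₁ → MvPolynomial (Fin n ⊕ Fin p) ℝ),
    IsSumOfSquares σ₀ ∧ (∀ k, IsSumOfSquares (σ k)) ∧ (∀ k, IsSumOfSquares (τ k)) ∧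
    f = σ₀ + ∑ k, σ k * rename Sum.inl (ht k) + ∑ k, τ k * rename Sum.inr (hh k)

/-- Membership in the `2d`-truncated quadratic module: as in `MemJointQM`, with
every summand of degree at most `2d`. -/
def MemTruncJointQM {n p s₁ s₃ : ℕ} (ht : Fin s₃ → MvPolynomial (Fin n) ℝ)
    (hh : Fin s₁ → MvPolynomial (Fin p) ℝ) (d : ℕ)
    (f : MvPolynomial (Fin n ⊕ Fin p) ℝ) : Prop :=
  ∃ (σ₀ : MvPolynomial (Fin n ⊕ Fin p) ℝ)
    (σ : Fin s₃ → MvPolynomial (Fin n ⊕ Fin p) ℝ)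
    (τ : Fin s₁ → MvPolynomial (Fin n ⊕ Fin p) ℝ),
    IsSumOfSquares σ₀ ∧ (∀ k, IsSumOfSquares (σ k)) ∧ (∀ k, IsSumOfSquares (τ k)) ∧
    σ₀.totalDegree ≤ 2 * d ∧
    (∀ k, (σ k * rename Sum.inl (ht k)).totalDegree ≤ 2 * d) ∧
    (∀ k, (τ k * rename Sum.inr (hh k)).totalDegree ≤ 2 * d) ∧
    f = σ₀ + ∑ k, σ k * rename Sum.inl (ht k) + ∑ k, τ k * rename Sum.inr (hh k)

/-- The feasible set `𝒫_d` of the `d`-th "joint+marginal" upper-approximation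
problem: polynomials `q ∈ ℝ[x]` of degree at most `d` with
`q(x) − f(x, u) ∈ Q_{2d}(h̃, ĥ)`. -/
def JMFeasible {n p s₁ s₃ : ℕ} (ht : Fin s₃ → MvPolynomial (Fin n) ℝ)
    (hh : Fin s₁ → MvPolynomial (Fin p) ℝ)
    (f : MvPolynomial (Fin n ⊕ Fin p) ℝ) (d : ℕ) :
    Set (MvPolynomial (Fin n) ℝ) :=
  {q | q.totalDegree ≤ d ∧ MemTruncJointQM ht hh d (rename Sum.inl q - f)}

section RealAlgebra

/-- Adjoining an element `a` to a preordering. -/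
theorem RingPreordering.exists_ge_of_not_mem {A : Type} [CommRing A] (P : RingPreordering A)
    (a : A) (h : ∀ s ∈ P, ∀ t ∈ P, s + a * t ≠ -1) :
    ∃ P' : RingPreordering A, P ≤ P' ∧ a ∈ P' := by
  refine ⟨RingPreordering.mk' {x | ∃ s ∈ P, ∃ t ∈ P, x = s + a * t} ?_ ?_ ?_ ?_, ?_, ?_⟩
  · rintro x y ⟨s, hs, t, ht, rfl⟩ ⟨s', hs', t', ht', rfl⟩
    exact ⟨s + s', add_mem hs hs', t + t', add_mem ht ht', by ring⟩
  · rintro x y ⟨s, hs, t, ht, rfl⟩ ⟨s', hs', t', ht', rfl⟩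
    exact ⟨s * s' + a ^ 2 * (t * t'),
      add_mem (mul_mem hs hs') (mul_mem (P.pow_two_mem a) (mul_mem ht ht')),
      s * t' + s' * t, add_mem (mul_mem hs ht') (mul_mem hs' ht), by ring⟩
  · intro x
    exact ⟨x * x, P.mul_self_mem x, 0, zero_mem P, by ring⟩
  · rintro ⟨s, hs, t, ht, he⟩
    exact h s hs t ht he.symm
  · intro x hx
    exact ⟨x, hx, 0, zero_mem P, by ring⟩
  · exact ⟨0, zero_mem P, 1, one_mem P, by ring⟩

/-- Every preordering of a commutative ring is contained in an ordering (a prime cone). -/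
theorem RingPreordering.exists_isOrdering_ge {A : Type} [CommRing A] (T : RingPreordering A) :
    ∃ P : RingPreordering A, T ≤ P ∧ P.IsOrdering := by
  obtain ⟨P, hTP, hP⟩ := zorn_le_nonempty₀ (Set.univ : Set (RingPreordering A))
    (fun c _ hc y hy => by
      have hdir : DirectedOn (· ≤ ·) c := hc.directedOn
      refine ⟨RingPreordering.mk' {x | ∃ Q ∈ c, x ∈ Q} ?_ ?_ ?_ ?_, trivial, ?_⟩
      · rintro x y ⟨Q, hQ, hx⟩ ⟨Q', hQ', hy⟩
        obtain ⟨Q'', hQ'', h1, h2⟩ := hdir Q hQ Q' hQ'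
        exact ⟨Q'', hQ'', add_mem (h1 hx) (h2 hy)⟩
      · rintro x y ⟨Q, hQ, hx⟩ ⟨Q', hQ', hy⟩
        obtain ⟨Q'', hQ'', h1, h2⟩ := hdir Q hQ Q' hQ'
        exact ⟨Q'', hQ'', mul_mem (h1 hx) (h2 hy)⟩
      · exact fun x => ⟨y, hy, y.mul_self_mem x⟩
      · rintro ⟨Q, -, hQ⟩
        exact Q.neg_one_notMem hQ
      · exact fun Q hQ x hx => ⟨Q, hQ, hx⟩) T trivial
  refine ⟨P, hTP, (RingPreordering.isOrdering_iff).2 fun a b hab => ?_⟩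
  by_contra! hcon
  have key : ∀ a, a ∉ P → ∃ s ∈ P, ∃ t ∈ P, s + a * t = -1 := by
    intro a ha
    by_contra! hno
    obtain ⟨P', hPP', haP'⟩ := P.exists_ge_of_not_mem a hno
    exact ha (hP.2 trivial hPP' haP')
  obtain ⟨s, hs, t, ht, h1⟩ := key a hcon.1
  obtain ⟨s', hs', t', ht', h2⟩ := key b hcon.2
  refine P.neg_one_notMem ?_
  have : (-1 : A) = s + s' + s * s' + -(a * b) * (t * t') := by
    linear_combination (-1 - s') * h1 + (a * t) * h2
  rw [this]
  exact add_mem (add_mem (add_mem hs hs') (mul_mem hs hs')) (mul_mem hab (mul_mem ht ht'))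

/-- A partial order cone of a ring that linearly orders the additive group it generates. -/
def RingCone.IsTotal {A : Type} [CommRing A] (C : RingCone A) : Prop :=
  ∀ x ∈ C, ∀ y ∈ C, x - y ∈ C ∨ y - x ∈ C

/-- The image of an ordering under a ring homomorphism whose kernel is its support. -/
theorem RingPreordering.exists_ringCone_map {A B : Type} [CommRing A] [CommRing B]
    (P : RingPreordering A) [P.IsOrdering] (ψ : A →+* B)
    (hψ : ∀ p, (p ∈ P ∧ -p ∈ P) ↔ ψ p = 0) :
    ∃ C : RingCone B, C.IsTotal ∧ (∀ p ∈ P, ψ p ∈ C) ∧ ∀ x ∈ C, ∃ p ∈ P, ψ p = x := by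
  refine ⟨{ P.toSubsemiring.map ψ with eq_zero_of_mem_of_neg_mem' := ?_ }, ?_, ?_, ?_⟩
  · rintro x ⟨p, hp, rfl⟩ ⟨q, hq, hpq⟩
    have hz : ψ (p + q) = 0 := by rw [map_add, hpq]; ring
    have h2 := ((hψ _).2 hz).2
    refine (hψ p).1 ⟨hp, ?_⟩
    have : -p = -(p + q) + q := by ring
    rw [this]
    exact add_mem h2 hq
  · rintro x ⟨p, hp, rfl⟩ y ⟨q, hq, rfl⟩
    rcases mem_or_neg_mem P (p - q) with h | h
    · exact Or.inl ⟨p - q, h, map_sub _ _ _⟩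
    · exact Or.inr ⟨q - p, by simpa using h, map_sub _ _ _⟩
  · exact fun p hp => ⟨p, hp, rfl⟩
  · rintro x ⟨p, hp, rfl⟩
    exact ⟨p, hp, rfl⟩

theorem RingCone.exists_maximal {A : Type} [CommRing A] (C₀ : RingCone A) (h₀ : C₀.IsTotal) :
    ∃ C : RingCone A, C₀ ≤ C ∧ Maximal RingCone.IsTotal C := by
  refine zorn_le_nonempty₀ {C : RingCone A | C.IsTotal} (fun c hcs hc y hy => ?_) C₀ h₀
  have hdir : DirectedOn (· ≤ ·) c := hc.directedOn
  have hcommon : ∀ x x', (∃ Q ∈ c, x ∈ Q) → (∃ Q ∈ c, x' ∈ Q) → ∃ Q ∈ c, x ∈ Q ∧ x' ∈ Q := by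
    rintro x x' ⟨Q, hQ, hx⟩ ⟨Q', hQ', hx'⟩
    obtain ⟨Q'', hQ'', h1, h2⟩ := hdir Q hQ Q' hQ'
    exact ⟨Q'', hQ'', h1 hx, h2 hx'⟩
  refine ⟨{ carrier := {x | ∃ Q ∈ c, x ∈ Q}
            add_mem' := ?_, mul_mem' := ?_, zero_mem' := ⟨y, hy, zero_mem y⟩
            one_mem' := ⟨y, hy, one_mem y⟩, eq_zero_of_mem_of_neg_mem' := ?_ }, ?_, ?_⟩
  · intro a b ha hb
    obtain ⟨Q, hQ, h1, h2⟩ := hcommon a b ha hb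
    exact ⟨Q, hQ, mul_mem h1 h2⟩
  · intro a b ha hb
    obtain ⟨Q, hQ, h1, h2⟩ := hcommon a b ha hb
    exact ⟨Q, hQ, add_mem h1 h2⟩
  · intro a ha hb
    obtain ⟨Q, hQ, h1, h2⟩ := hcommon a (-a) ha hb
    exact eq_zero_of_mem_of_neg_mem h1 h2
  · intro a ha b hb
    obtain ⟨Q, hQ, h1, h2⟩ := hcommon a b ha hb
    exact (hcs hQ a h1 b h2).imp (fun h => ⟨Q, hQ, h⟩) (fun h => ⟨Q, hQ, h⟩)
  · exact fun Q hQ x hx => ⟨Q, hQ, hx⟩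

theorem RingCone.IsTotal.exists_linearOrder {E : Type} [Field E] (C : RingCone E)
    (hC : ∀ x, x ∈ C ∨ -x ∈ C) :
    ∃ (_ : LinearOrder E), IsStrictOrderedRing E ∧ ∀ x : E, 0 ≤ x ↔ x ∈ C := by
  classical
  have : HasMemOrNegMem C := ⟨hC⟩
  let _ : LinearOrder E := LinearOrder.mkOfAddGroupCone C
  have : IsOrderedRing E := IsOrderedRing.mkOfCone C
  refine ⟨inferInstance, inferInstance, fun x => ?_⟩
  change x - 0 ∈ C ↔ _
  rw [sub_zero]

/-- The intermediate value property for polynomials over an ordered field. -/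
def PolyIVT (R : Type) [Field R] [LinearOrder R] : Prop :=
  ∀ (f : Polynomial R) (a b : R), a < b → f.eval a * f.eval b < 0 →
    ∃ c, a < c ∧ c < b ∧ f.eval c = 0

/-- The subfield generated by a maximal total cone. -/
theorem RingCone.exists_subfield {Ω : Type} [Field Ω] (C : RingCone Ω)
    (hC : Maximal RingCone.IsTotal C) : ∃ E : Subfield Ω, ∀ x, x ∈ E ↔ x ∈ C ∨ -x ∈ C := by
  have htot := hC.1
  have hinv : ∀ b ∈ C, b ≠ 0 → b⁻¹ ∈ C := by
    have : ∃ C' : RingCone Ω, C'.IsTotal ∧ ∀ x, x ∈ C' ↔ ∃ b ∈ C, b ≠ 0 ∧ b * x ∈ C := by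
      refine ⟨{ carrier := {x | ∃ b ∈ C, b ≠ 0 ∧ b * x ∈ C}
                add_mem' := ?_, mul_mem' := ?_
                zero_mem' := ⟨1, one_mem C, one_ne_zero, by simp⟩
                one_mem' := ⟨1, one_mem C, one_ne_zero, by simp⟩
                eq_zero_of_mem_of_neg_mem' := ?_ }, ?_, fun x => Iff.rfl⟩
      · rintro x y ⟨b, hb, hb0, hx⟩ ⟨b', hb', hb0', hy⟩
        refine ⟨b * b', mul_mem hb hb', mul_ne_zero hb0 hb0', ?_⟩
        rw [show b * b' * (x * y) = (b * x) * (b' * y) by ring]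
        exact mul_mem hx hy
      · rintro x y ⟨b, hb, hb0, hx⟩ ⟨b', hb', hb0', hy⟩
        refine ⟨b * b', mul_mem hb hb', mul_ne_zero hb0 hb0', ?_⟩
        rw [show b * b' * (x + y) = b' * (b * x) + b * (b' * y) by ring]
        exact add_mem (mul_mem hb' hx) (mul_mem hb hy)
      · rintro x ⟨b, hb, hb0, hx⟩ ⟨b', hb', hb0', hy⟩
        have h1 := mul_mem hb' hx
        have h2 := mul_mem hb hy
        rw [show b * (b' * -x) = -(b' * (b * x)) by ring] at h2
        have := eq_zero_of_mem_of_neg_mem h1 h2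
        simpa [hb0, hb0'] using this
      · rintro x ⟨b, hb, hb0, hx⟩ y ⟨b', hb', hb0', hy⟩
        refine (htot _ (mul_mem hb' hx) _ (mul_mem hb hy)).imp (fun h => ?_) (fun h => ?_)
        · refine ⟨b * b', mul_mem hb hb', mul_ne_zero hb0 hb0', ?_⟩
          rw [show b * b' * (x - y) = b' * (b * x) - b * (b' * y) by ring]
          exact h
        · refine ⟨b * b', mul_mem hb hb', mul_ne_zero hb0 hb0', ?_⟩
          rw [show b * b' * (y - x) = b * (b' * y) - b' * (b * x) by ring]
          exact h
    obtain ⟨C', hC', hmem⟩ := this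
    have hle : C ≤ C' := fun x hx => (hmem x).2 ⟨1, one_mem C, one_ne_zero, by simpa using hx⟩
    intro b hb hb0
    exact hC.2 hC' hle ((hmem _).2 ⟨b, hb, hb0, by simp [hb0, one_mem]⟩)
  have hneg : ∀ x, x ∈ C ∨ -x ∈ C → -x ∈ C ∨ - -x ∈ C := fun x h => by simpa using h.symm
  refine ⟨{ carrier := {x | x ∈ C ∨ -x ∈ C}
            mul_mem' := ?_, one_mem' := Or.inl (one_mem C), add_mem' := ?_
            zero_mem' := Or.inl (zero_mem C), neg_mem' := fun {x} => hneg x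
            inv_mem' := ?_ }, fun x => Iff.rfl⟩
  · rintro x y (hx | hx) (hy | hy)
    · exact Or.inl (mul_mem hx hy)
    · exact Or.inr (by simpa using mul_mem hx hy)
    · exact Or.inr (by simpa using mul_mem hx hy)
    · exact Or.inl (by simpa using mul_mem hx hy)
  · rintro x y (hx | hx) (hy | hy)
    · exact Or.inl (add_mem hx hy)
    · simpa [sub_eq_add_neg] using htot _ hx _ hy
    · simpa [sub_eq_add_neg, add_comm] using htot _ hy _ hx
    · exact Or.inr (by simpa [add_comm] using add_mem hx hy)
  · rintro x (hx | hx)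
    · by_cases h0 : x = 0
      · subst h0; simp
      · exact Or.inl (hinv x hx h0)
    · by_cases h0 : x = 0
      · subst h0; simp
      · exact Or.inr (by simpa [inv_neg] using hinv _ hx (neg_ne_zero.2 h0))

theorem lt_and_lt_of_mul_neg {K : Type} [Field K] [LinearOrder K] [IsStrictOrderedRing K]
    {a b c t : K} (hab : a < b) (h : (a - t) * c * ((b - t) * c) < 0) : a < t ∧ t < b := by
  have hs : (a - t) * (b - t) < 0 := by
    by_contra! hge
    nlinarith [mul_nonneg hge (sq_nonneg c)]
  constructor
  · by_contra! hle
    nlinarith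
  · by_contra! hle
    nlinarith

set_option maxHeartbeats 800000 in
theorem RingCone.polyIVT {Ω : Type} [Field Ω] [IsAlgClosed Ω] (C : RingCone Ω)
    (hC : Maximal RingCone.IsTotal C) (E : Subfield Ω) (hE : ∀ x, x ∈ E ↔ x ∈ C ∨ -x ∈ C)
    [LinearOrder E] [IsStrictOrderedRing E] (hord : ∀ x : E, 0 ≤ x ↔ (x : Ω) ∈ C) :
    PolyIVT E := by
  suffices H : ∀ d, ∀ (f : Polynomial E), f.natDegree = d → ∀ a b, a < b →
      f.eval a * f.eval b < 0 → ∃ c, a < c ∧ c < b ∧ f.eval c = 0 from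
    fun f a b => H _ f rfl a b
  intro d
  induction d using Nat.strong_induction_on with
  | _ d ih =>
  intro f hfd a b hab hsign
  by_contra! hno
  have hf0 : f ≠ 0 := by rintro rfl; simp at hsign
  have hd0 : d ≠ 0 := by
    rintro rfl
    obtain ⟨c, rfl⟩ := Polynomial.natDegree_eq_zero.1 hfd
    simp only [Polynomial.eval_C] at hsign
    exact absurd (mul_self_nonneg c) (not_le.2 hsign)
  have hirr : Irreducible f := by
    refine ⟨fun hu => hd0 (hfd ▸ Polynomial.natDegree_eq_zero_of_isUnit hu), ?_⟩
    intro g h hgh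
    by_contra! hcon
    have hg0 : g ≠ 0 := by rintro rfl; simp [hgh] at hf0
    have hh0 : h ≠ 0 := by rintro rfl; simp [hgh] at hf0
    have hg1 : g.natDegree ≠ 0 := fun h0 => hcon.1 (by
      rw [Polynomial.isUnit_iff_degree_eq_zero, Polynomial.degree_eq_natDegree hg0, h0]; rfl)
    have hh1 : h.natDegree ≠ 0 := fun h0 => hcon.2 (by
      rw [Polynomial.isUnit_iff_degree_eq_zero, Polynomial.degree_eq_natDegree hh0, h0]; rfl)
    have hdeg : d = g.natDegree + h.natDegree := by
      rw [← hfd, hgh, Polynomial.natDegree_mul hg0 hh0]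
    have hprod : (g.eval a * g.eval b) * (h.eval a * h.eval b) < 0 := by
      rw [hgh] at hsign
      simp only [Polynomial.eval_mul] at hsign
      linarith [hsign]
    rcases mul_neg_iff.1 hprod with ⟨-, hn⟩ | ⟨hn, -⟩
    · obtain ⟨c, h1, h2, h3⟩ := ih _ (by omega) h rfl a b hab hn
      exact hno c h1 h2 (by rw [hgh, Polynomial.eval_mul, h3, mul_zero])
    · obtain ⟨c, h1, h2, h3⟩ := ih _ (by omega) g rfl a b hab hn
      exact hno c h1 h2 (by rw [hgh, Polynomial.eval_mul, h3, zero_mul])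
  obtain ⟨θ, hθ⟩ := IsAlgClosed.exists_aeval_eq_zero Ω f
    (by rw [Polynomial.degree_eq_natDegree hf0, hfd]; exact_mod_cast hd0)
  let M : Submonoid (Polynomial E) :=
    { carrier := {w | ∃ (c : E) (h : Polynomial E), 0 ≤ c ∧ w = Polynomial.C c * h ^ 2}
      one_mem' := ⟨1, 1, zero_le_one, by simp⟩
      mul_mem' := by
        rintro _ _ ⟨c, h, hc, rfl⟩ ⟨c', h', hc', rfl⟩
        exact ⟨c * c', h * h', mul_nonneg hc hc', by rw [Polynomial.C_mul]; ring⟩ }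
  let W := M.subsemiringClosure
  have hW : ∀ w ∈ W, ∃ w' : Polynomial E, f ∣ w - w' ∧ (∀ x, 0 ≤ w'.eval x) ∧
      w'.natDegree ≤ 2 * (d - 1) := by
    intro w hw
    have hw' : w ∈ AddSubmonoid.closure (M : Set (Polynomial E)) := by
      have := M.subsemiringClosure_coe ▸ (show w ∈ (W : Set (Polynomial E)) from hw)
      exact this
    induction hw' using AddSubmonoid.closure_induction with
    | mem x hx =>
      obtain ⟨c, h, hc, rfl⟩ := hx
      refine ⟨Polynomial.C c * (h % f) ^ 2, ?_, fun x => ?_, ?_⟩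
      · have h1 : f ∣ h - h % f := ⟨h / f, by
          linear_combination -(EuclideanDomain.div_add_mod h f)⟩
        rw [← mul_sub, sq_sub_sq]
        exact (h1.mul_left _).mul_left _
      · simp only [Polynomial.eval_mul, Polynomial.eval_C, Polynomial.eval_pow]
        positivity
      · have h2 : (h % f).natDegree ≤ d - 1 := by
          have := Polynomial.natDegree_mod_lt h (q := f) (by omega)
          omega
        calc _ ≤ ((h % f) ^ 2).natDegree := Polynomial.natDegree_C_mul_le _ _
          _ ≤ 2 * (h % f).natDegree := Polynomial.natDegree_pow_le
          _ ≤ _ := by omega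
    | zero => exact ⟨0, by simp, by simp, by simp⟩
    | add x y hx hy ihx ihy =>
      have hmem : ∀ z ∈ AddSubmonoid.closure (M : Set (Polynomial E)), z ∈ W := fun z hz => by
        have : z ∈ (W : Set (Polynomial E)) := by
          rw [Submonoid.subsemiringClosure_coe]; exact hz
        exact this
      obtain ⟨x', h1, h2, h3⟩ := ihx (hmem _ hx)
      obtain ⟨y', h4, h5, h6⟩ := ihy (hmem _ hy)
      refine ⟨x' + y', ?_, fun z => ?_, ?_⟩
      · rw [show x + y - (x' + y') = (x - x') + (y - y') by ring]
        exact dvd_add h1 h4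
      · rw [Polynomial.eval_add]; exact add_nonneg (h2 z) (h5 z)
      · exact (Polynomial.natDegree_add_le _ _).trans (max_le h3 h6)
  have hMW : ∀ w ∈ M, w ∈ W := fun w hw => by
    have : w ∈ (W : Set (Polynomial E)) := by
      rw [Submonoid.subsemiringClosure_coe]; exact AddSubmonoid.subset_closure hw
    exact this
  have hneg : ¬ ∃ w ∈ W, f ∣ -1 - w := by
    rintro ⟨w, hw, hdvd⟩
    obtain ⟨w', hww', hpos, hdeg⟩ := hW w hw
    have h1 : f ∣ 1 + w' := by
      have := dvd_add hdvd hww'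
      rw [show (-1 - w + (w - w')) = -(1 + w') by ring] at this
      exact (dvd_neg.1 this)
    obtain ⟨g, hg⟩ := h1
    have hp : ∀ x, 0 < f.eval x * g.eval x := fun x => by
      rw [← Polynomial.eval_mul, ← hg, Polynomial.eval_add, Polynomial.eval_one]
      linarith [hpos x]
    have hg0 : g ≠ 0 := by
      rintro rfl
      simpa using hp 0
    have hgdeg : g.natDegree < d := by
      have e1 : (f * g).natDegree = d + g.natDegree := by
        rw [Polynomial.natDegree_mul hf0 hg0, hfd]
      have e2 : (1 + w').natDegree ≤ 2 * (d - 1) :=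
        (Polynomial.natDegree_add_le _ _).trans (max_le (by simp) hdeg)
      rw [hg, e1] at e2
      omega
    have hgs : g.eval a * g.eval b < 0 := by
      have := mul_pos (hp a) (hp b)
      by_contra! hge
      have := mul_nonpos_of_nonpos_of_nonneg hsign.le hge
      nlinarith
    obtain ⟨r, -, -, hr⟩ := ih _ hgdeg g rfl a b hab hgs
    have := hp r
    rw [hr, mul_zero] at this
    exact lt_irrefl _ this
  obtain ⟨P, hTP, hP⟩ := RingPreordering.exists_isOrdering_ge
    (RingPreordering.mk' {x : Polynomial E | ∃ w ∈ W, f ∣ x - w}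
      (by
        rintro x y ⟨w, hw, h1⟩ ⟨w', hw', h2⟩
        refine ⟨w + w', add_mem hw hw', ?_⟩
        rw [show x + y - (w + w') = (x - w) + (y - w') by ring]
        exact dvd_add h1 h2)
      (by
        rintro x y ⟨w, hw, h1⟩ ⟨w', hw', h2⟩
        refine ⟨w * w', mul_mem hw hw', ?_⟩
        rw [show x * y - (w * w') = (x - w) * y + w * (y - w') by ring]
        exact dvd_add (h1.mul_right _) (h2.mul_left _))
      (fun x => ⟨x * x, hMW _ ⟨1, x, zero_le_one, by simp [sq]⟩, by simp⟩) hneg)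
  have hfP : ∀ p, f ∣ p → p ∈ P := fun p hp => hTP ⟨0, zero_mem W, by simpa using hp⟩
  have hcop : ∀ p, ¬ f ∣ p → ∃ u v, u * f + v * p = 1 := fun p hp =>
    (hirr.coprime_iff_not_dvd.2 hp : IsCoprime f p)
  have hψ : ∀ p, (p ∈ P ∧ -p ∈ P) ↔
      ((Polynomial.aeval θ : Polynomial E →ₐ[E] Ω) : Polynomial E →+* Ω) p = 0 := by
    intro p
    by_cases hp : f ∣ p
    · refine ⟨fun _ => ?_, fun _ => ⟨hfP _ hp, hfP _ (dvd_neg.2 hp)⟩⟩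
      obtain ⟨k, rfl⟩ := hp
      simp [hθ]
    · obtain ⟨u, v, huv⟩ := hcop p hp
      refine ⟨fun ⟨h1, h2⟩ => ?_, fun h0 => ?_⟩
      · refine (P.neg_one_notMem ?_).elim
        rw [← huv, neg_add]
        exact add_mem (hfP _ (dvd_neg.2 (Dvd.intro_left _ rfl)))
          (RingPreordering.HasIdealSupport.neg_smul_mem v h1 h2)
      · have h0' : Polynomial.aeval θ p = 0 := h0
        have := congrArg (Polynomial.aeval θ) huv
        simp [hθ, h0'] at this
  obtain ⟨C', hC', hPC', -⟩ := P.exists_ringCone_map _ hψ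
  have hle : C ≤ C' := by
    intro c hc
    have hcE : c ∈ E := (hE c).2 (Or.inl hc)
    have := hPC' (Polynomial.C ⟨c, hcE⟩)
      (hTP ⟨_, hMW _ ⟨⟨c, hcE⟩, 1, (hord _).2 hc, rfl⟩, by simp⟩)
    have e : ((Polynomial.aeval θ : Polynomial E →ₐ[E] Ω) : Polynomial E →+* Ω)
        (Polynomial.C ⟨c, hcE⟩) = c := by
      change Polynomial.aeval θ (Polynomial.C (⟨c, hcE⟩ : E)) = c
      rw [Polynomial.aeval_C]
      rfl
    rwa [e] at this
  have hle' : C' ≤ C := hC.2 hC' hle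
  have hθE : θ ∈ E := by
    have e : ((Polynomial.aeval θ : Polynomial E →ₐ[E] Ω) : Polynomial E →+* Ω)
        Polynomial.X = θ := Polynomial.aeval_X θ
    rw [hE]
    refine (mem_or_neg_mem P (Polynomial.X : Polynomial E)).imp (fun h => ?_) (fun h => ?_)
    · have := hle' (hPC' _ h)
      rwa [e] at this
    · have := hle' (hPC' _ h)
      rwa [map_neg, e] at this
  have hroot : f.IsRoot ⟨θ, hθE⟩ := by
    have h1 : Polynomial.aeval (algebraMap E Ω ⟨θ, hθE⟩) f = 0 := hθ
    rw [Polynomial.aeval_algebraMap_apply] at h1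
    exact (algebraMap E Ω).injective (by simpa using h1)
  obtain ⟨g, hg⟩ := Polynomial.dvd_iff_isRoot.2 hroot
  have hgu := (hirr.isUnit_or_isUnit hg).resolve_left (Polynomial.not_isUnit_X_sub_C _)
  obtain ⟨c, hc, rfl⟩ := Polynomial.isUnit_iff.1 hgu
  have hev : ∀ x, f.eval x = (x - ⟨θ, hθE⟩) * c := fun x => by rw [hg]; simp
  set t : E := ⟨θ, hθE⟩
  rw [hev, hev] at hsign
  have hs := lt_and_lt_of_mul_neg hab hsign
  exact hno t hs.1 hs.2 (by rw [hev, sub_self, zero_mul])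

theorem exists_injective_isAlgClosed (Q : Type) [CommRing Q] [IsDomain Q] :
    ∃ (Ω : Type) (_ : Field Ω) (_ : IsAlgClosed Ω) (ι : Q →+* Ω), Function.Injective ι :=
  ⟨AlgebraicClosure (FractionRing Q), inferInstance, inferInstance,
    (algebraMap (FractionRing Q) _).comp (algebraMap Q (FractionRing Q)),
    (algebraMap (FractionRing Q) _).injective.comp (IsFractionRing.injective Q _)⟩

/-- A ring with a preordering maps to an ordered field with the intermediate value property
for polynomials, in such a way that elements of the preordering become nonnegative. -/
theorem RingPreordering.exists_ringHom_polyIVT {A : Type} [CommRing A] (T : RingPreordering A) :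
    ∃ (R : Type) (_ : Field R) (_ : LinearOrder R) (_ : IsStrictOrderedRing R),
      PolyIVT R ∧ ∃ ψ : A →+* R, ∀ t ∈ T, 0 ≤ ψ t := by
  obtain ⟨P, hTP, hP⟩ := T.exists_isOrdering_ge
  obtain ⟨Ω, _, _, ι, hι⟩ := exists_injective_isAlgClosed (A ⧸ P.support)
  let ψ : A →+* Ω := ι.comp (Ideal.Quotient.mk P.support)
  have hψ : ∀ p, (p ∈ P ∧ -p ∈ P) ↔ ψ p = 0 := by
    intro p
    change _ ↔ ι (Ideal.Quotient.mk P.support p) = 0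
    rw [map_eq_zero_iff _ hι, Ideal.Quotient.eq_zero_iff_mem, RingPreordering.mem_support]
  obtain ⟨C₀, hC₀, hPC, -⟩ := P.exists_ringCone_map ψ hψ
  obtain ⟨C, hle, hmax⟩ := RingCone.exists_maximal C₀ hC₀
  obtain ⟨E, hE⟩ := C.exists_subfield hmax
  obtain ⟨_, hord, hnn⟩ := RingCone.IsTotal.exists_linearOrder
    ({ C.toSubsemiring.comap E.subtype with
        eq_zero_of_mem_of_neg_mem' := fun {x} h1 h2 => by
          have := eq_zero_of_mem_of_neg_mem (C := C) (a := (x : Ω)) h1 h2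
          exact_mod_cast this } : RingCone E) (fun x => (hE x).1 x.2)
  have hψE : ∀ p, ψ p ∈ E := fun p => by
    rw [hE]
    refine (mem_or_neg_mem P p).imp (fun h => hle (hPC _ h)) (fun h => ?_)
    rw [← map_neg]
    exact hle (hPC _ h)
  exact ⟨E, inferInstance, inferInstance, hord, C.polyIVT hmax E hE hnn, ψ.codRestrict E hψE,
    fun t ht => (hnn _).2 (hle (hPC _ (hTP ht)))⟩

end RealAlgebra

namespace Polynomial

variable {R : Type} [Field R] [LinearOrder R] [IsStrictOrderedRing R]

theorem _root_.PolyIVT.rolle (hR : PolyIVT R) (f : R[X]) {a b : R} (hab : a < b)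
    (ha : f.eval a = 0) (hb : f.eval b = 0) : ∃ c, a < c ∧ c < b ∧ f.derivative.eval c = 0 := by
  classical
  by_cases hf : f = 0
  · obtain ⟨c, h1, h2⟩ := exists_between hab
    exact ⟨c, h1, h2, by simp [hf]⟩
  have hbmem : b ∈ f.roots.toFinset.filter (a < ·) := by
    simp [hf, hab, hb]
  obtain ⟨b', hb'mem, hmin⟩ := Finset.exists_min_image (f.roots.toFinset.filter (a < ·)) id ⟨b, hbmem⟩
  have hb'b : b' ≤ b := hmin b hbmem
  simp only [Finset.mem_filter, Multiset.mem_toFinset, mem_roots hf, IsRoot.def] at hb'mem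
  obtain ⟨hb'0, hab'⟩ := hb'mem
  obtain ⟨f₁, hf₁, hf₁'⟩ := exists_eq_pow_rootMultiplicity_mul_and_not_dvd f hf a
  have hf₁0 : f₁ ≠ 0 := by rintro rfl; simp at hf₁'
  obtain ⟨g, hg, hg'⟩ := exists_eq_pow_rootMultiplicity_mul_and_not_dvd f₁ hf₁0 b'
  have hm : rootMultiplicity a f ≠ 0 := ((rootMultiplicity_pos hf).2 ha).ne'
  have hn : rootMultiplicity b' f₁ ≠ 0 := by
    refine ((rootMultiplicity_pos hf₁0).2 ?_).ne'
    have := hb'0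
    rw [hf₁, eval_mul] at this
    refine (mul_eq_zero.1 this).resolve_left ?_
    simp [sub_eq_zero, hab'.ne', hm]
  obtain ⟨m, hm⟩ := Nat.exists_eq_succ_of_ne_zero hm
  obtain ⟨n, hn⟩ := Nat.exists_eq_succ_of_ne_zero hn
  rw [hm] at hf₁
  rw [hn] at hg
  have hfg : f = (X - C a) ^ (m + 1) * ((X - C b') ^ (n + 1) * g) := by rw [hf₁, ← hg]
  have hga : g.eval a ≠ 0 := by
    intro h
    apply hf₁'
    rw [dvd_iff_isRoot, IsRoot.def, hg, eval_mul, h, mul_zero]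
  have hgb : g.eval b' ≠ 0 := by
    intro h
    exact hg' (dvd_iff_isRoot.2 h)
  have hgg : 0 < g.eval a * g.eval b' := by
    by_contra! hle
    obtain ⟨c, h1, h2, h3⟩ := hR g a b' hab' (lt_of_le_of_ne hle (mul_ne_zero hga hgb))
    have hc : c ∈ f.roots.toFinset.filter (a < ·) := by
      simp only [Finset.mem_filter, Multiset.mem_toFinset, mem_roots hf, IsRoot.def]
      exact ⟨by rw [hfg]; simp [h3], h1⟩
    exact absurd (hmin c hc) (not_le.2 h2)
  set B : R[X] := (m + 1 : R[X]) * (X - C b') * g + (n + 1 : R[X]) * (X - C a) * g +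
    (X - C a) * (X - C b') * derivative g with hB
  have hder : derivative f = (X - C a) ^ m * (X - C b') ^ n * B := by
    rw [hfg, hB]
    simp only [derivative_mul, derivative_X_sub_C_pow, Nat.add_sub_cancel]
    push_cast
    simp only [C_add, C_1, map_natCast]
    ring
  have hBa : B.eval a = (m + 1) * (a - b') * g.eval a := by simp [hB]
  have hBb : B.eval b' = (n + 1) * (b' - a) * g.eval b' := by simp [hB]
  have hBB : B.eval a * B.eval b' < 0 := by
    rw [hBa, hBb]
    have h1 : (0 : R) < (m + 1) * (n + 1) * (b' - a) ^ 2 := by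
      have := sub_pos.2 hab'
      positivity
    nlinarith [mul_pos h1 hgg]
  obtain ⟨c, h1, h2, h3⟩ := hR B a b' hab' hBB
  exact ⟨c, h1, h2.trans_le hb'b, by rw [hder, eval_mul, h3, mul_zero]⟩

/-- A polynomial with a root in an interval without critical points changes sign there. -/
theorem _root_.PolyIVT.mul_neg_of_root (hR : PolyIVT R) (f : R[X]) {p α q : R} (hpα : p < α)
    (hαq : α < q) (hp : f.eval p ≠ 0) (hq : f.eval q ≠ 0) (hα : f.eval α = 0)
    (hf : ∀ c, p < c → c < q → f.derivative.eval c ≠ 0) : f.eval p * f.eval q < 0 := by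
  obtain ⟨g, hg⟩ := dvd_iff_isRoot.2 (show f.IsRoot α from hα)
  by_contra! hge
  have hpos : 0 < f.eval p * f.eval q := lt_of_le_of_ne hge (mul_ne_zero hp hq).symm
  have hgneg : g.eval p * g.eval q < 0 := by
    rw [hg] at hpos
    simp only [eval_mul, eval_sub, eval_X, eval_C] at hpos
    by_contra! hge'
    nlinarith [mul_nonneg (mul_nonneg (sub_pos.2 hpα).le (sub_pos.2 hαq).le) hge']
  obtain ⟨β, h1, h2, h3⟩ := hR g p q (hpα.trans hαq) hgneg
  have hβ : f.eval β = 0 := by rw [hg, eval_mul, h3, mul_zero]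
  rcases lt_trichotomy α β with h | rfl | h
  · obtain ⟨c, hc1, hc2, hc3⟩ := hR.rolle f h hα hβ
    exact hf c (hpα.trans hc1) (hc2.trans h2) hc3
  · refine hf α hpα hαq ?_
    rw [hg]
    simp [h3]
  · obtain ⟨c, hc1, hc2, hc3⟩ := hR.rolle f h hβ hα
    exact hf c (h1.trans hc1) (hc2.trans hαq) hc3

theorem _root_.PolyIVT.lt_root_iff (hR : PolyIVT R) (f : R[X]) {p α q x : R} (hpα : p < α)
    (hαq : α < q) (hp : f.eval p ≠ 0) (hq : f.eval q ≠ 0) (hα : f.eval α = 0)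
    (hf : ∀ c, p < c → c < q → f.derivative.eval c ≠ 0) (hpx : p < x) (hxq : x < q)
    (hx : f.eval x ≠ 0) : x < α ↔ f.eval x * f.eval q < 0 := by
  constructor
  · intro h
    exact hR.mul_neg_of_root f h hαq hx hq hα (fun c h1 h2 => hf c (hpx.trans h1) h2)
  · intro h
    by_contra! hle
    have hlt : α < x := lt_of_le_of_ne hle (by rintro rfl; exact hx hα)
    have h1 := hR.mul_neg_of_root f hpα hαq hp hq hα hf
    have h2 := hR.mul_neg_of_root f hpα hlt hp hx hα (fun c h1 h2 => hf c h1 (h2.trans hxq))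
    nlinarith [mul_pos_of_neg_of_neg h h1, mul_pos_of_neg_of_neg h h2, mul_pos_of_neg_of_neg h1 h2,
      mul_self_pos.2 hx, mul_self_pos.2 hp, mul_self_pos.2 hq]

theorem _root_.PolyIVT.pos_iff_pos (hR : PolyIVT R) (f : R[X]) {x y : R} (hx : f.eval x ≠ 0)
    (hy : f.eval y ≠ 0) (hf : ∀ c, f.eval c = 0 → (c < x ↔ c < y)) :
    0 < f.eval x ↔ 0 < f.eval y := by
  by_contra hcon
  have hneg : f.eval x * f.eval y < 0 := by
    rcases lt_or_gt_of_ne hx with h1 | h1 <;> rcases lt_or_gt_of_ne hy with h2 | h2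
    · exact (hcon ⟨fun h => absurd h h1.not_gt, fun h => absurd h h2.not_gt⟩).elim
    · exact mul_neg_of_neg_of_pos h1 h2
    · exact mul_neg_of_pos_of_neg h1 h2
    · exact (hcon ⟨fun _ => h2, fun _ => h1⟩).elim
  rcases lt_trichotomy x y with h | rfl | h
  · obtain ⟨c, h1, h2, h3⟩ := hR f x y h hneg
    exact absurd ((hf c h3).2 h2) h1.not_gt
  · exact absurd hneg (mul_self_nonneg _).not_gt
  · obtain ⟨c, h1, h2, h3⟩ := hR f y x h (by rwa [mul_comm])
    exact absurd ((hf c h3).1 h2) h1.not_gt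

variable {K : Type} [Field K]

/-- The elements of a finite set `Z` adjacent to a point `y` of an extension. -/
theorem exists_adjacent (i : K →+* R) (Z : Finset K) (y : R) :
    ∃ p q : K, i p < i q ∧ (∀ z ∈ Z, i z < y → i z ≤ i p) ∧ (∀ z ∈ Z, y < i z → i q ≤ i z) ∧
      ((∃ z ∈ Z, i z < y) → i p < y) ∧ ((∃ z ∈ Z, y < i z) → y < i q) := by
  classical
  have hA : (∃ z ∈ Z, i z < y) → ∃ p, i p < y ∧ ∀ z ∈ Z, i z < y → i z ≤ i p := by
    rintro ⟨z, hz, hzy⟩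
    obtain ⟨p, hp, hmax⟩ := Finset.exists_max_image (Z.filter (i · < y)) i ⟨z, by simp [hz, hzy]⟩
    exact ⟨p, (Finset.mem_filter.1 hp).2, fun z hz hzy => hmax z (by simp [hz, hzy])⟩
  have hB : (∃ z ∈ Z, y < i z) → ∃ q, y < i q ∧ ∀ z ∈ Z, y < i z → i q ≤ i z := by
    rintro ⟨z, hz, hzy⟩
    obtain ⟨p, hp, hmin⟩ := Finset.exists_min_image (Z.filter (y < i ·)) i ⟨z, by simp [hz, hzy]⟩
    exact ⟨p, (Finset.mem_filter.1 hp).2, fun z hz hzy => hmin z (by simp [hz, hzy])⟩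
  by_cases h1 : ∃ z ∈ Z, i z < y <;> by_cases h2 : ∃ z ∈ Z, y < i z
  · obtain ⟨p, hp, hp'⟩ := hA h1
    obtain ⟨q, hq, hq'⟩ := hB h2
    exact ⟨p, q, hp.trans hq, hp', hq', fun _ => hp, fun _ => hq⟩
  · obtain ⟨p, hp, hp'⟩ := hA h1
    exact ⟨p, p + 1, by simp, hp', fun z hz h => (h2 ⟨z, hz, h⟩).elim, fun _ => hp,
      fun h => (h2 h).elim⟩
  · obtain ⟨q, hq, hq'⟩ := hB h2
    exact ⟨q - 1, q, by simp, fun z hz h => (h1 ⟨z, hz, h⟩).elim, hq', fun h => (h1 h).elim,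
      fun _ => hq⟩
  · exact ⟨0, 1, by simp, fun z hz h => (h1 ⟨z, hz, h⟩).elim, fun z hz h => (h2 ⟨z, hz, h⟩).elim,
      fun h => (h1 h).elim, fun h => (h2 h).elim⟩

theorem exists_mem_gap (i : K →+* R) (Z : Finset K) (y : R) (hy : ∀ z, i z ≠ y) :
    ∃ m : K, ∀ z ∈ Z, (i z < y ↔ i z < i m) ∧ i z ≠ i m := by
  obtain ⟨p, q, hpq, hA, hB, -, -⟩ := exists_adjacent i Z y
  have hm : i ((p + q) / 2) = (i p + i q) / 2 := by rw [map_div₀, map_add, map_ofNat]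
  refine ⟨(p + q) / 2, fun z hz => ?_⟩
  rw [hm]
  rcases lt_or_gt_of_ne (hy z) with h | h
  · have := hA z hz h
    exact ⟨⟨fun _ => by linarith, fun _ => h⟩, by linarith⟩
  · have := hB z hz h
    exact ⟨⟨fun h' => absurd h' h.not_gt, fun h' => by linarith⟩, by linarith⟩

/-- Non-constant polynomials over `K` take infinitely large values at infinitely large points. -/
theorem forall_lt_abs_eval (i : K →+* R) {x : R} (hx : ∀ k, i k < x) :
    ∀ (n : ℕ) (g : K[X]), g.natDegree = n + 1 → ∀ k, i k < |(g.map i).eval x| := by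
  have habs : ∀ c, ∃ c', i c' = |i c| := fun c => by
    rcases abs_choice (i c) with h | h
    · exact ⟨c, h.symm⟩
    · exact ⟨-c, by rw [h, map_neg]⟩
  intro n
  induction n with
  | zero =>
    intro g hg k
    obtain ⟨c, hc0, b, rfl⟩ := natDegree_eq_one.1 hg
    simp only [Polynomial.map_add, Polynomial.map_mul, map_C, map_X, eval_add, eval_mul, eval_C,
      eval_X]
    obtain ⟨c', hc'⟩ := habs c
    obtain ⟨b', hb'⟩ := habs b
    have hc'0 : 0 < i c' := by rw [hc']; simpa using hc0
    have h1 := hx ((k + b') / c')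
    rw [map_div₀, div_lt_iff₀ hc'0, map_add] at h1
    have hx0 : 0 < x := by simpa using hx 0
    have h2 : |i c * x| = x * i c' := by rw [abs_mul, hc', abs_of_pos hx0, mul_comm]
    have h3 := abs_sub_abs_le_abs_sub (i c * x) (-i b)
    rw [abs_neg, sub_neg_eq_add, h2, ← hb'] at h3
    linarith
  | succ n ih =>
    intro g hg k
    have hdiv : g.divX.natDegree = n + 1 := by rw [natDegree_divX_eq_natDegree_tsub_one, hg]; rfl
    have h1 := ih g.divX hdiv 1
    obtain ⟨b', hb'⟩ := habs (g.coeff 0)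
    have hx0 : 0 < x := by simpa using hx 0
    have hgx : (g.map i).eval x = (g.divX.map i).eval x * x + i (g.coeff 0) := by
      conv_lhs => rw [← divX_mul_X_add g]
      simp
    rw [hgx]
    have h3 := abs_sub_abs_le_abs_sub ((g.divX.map i).eval x * x) (-i (g.coeff 0))
    rw [abs_neg, sub_neg_eq_add, abs_mul, abs_of_pos hx0, ← hb'] at h3
    rw [map_one] at h1
    have h4 := hx (k + b')
    rw [map_add] at h4
    nlinarith

theorem exists_le_of_isRoot (i : K →+* R) (f : K[X]) (hf : f.natDegree ≠ 0) {α : R}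
    (hα : (f.map i).eval α = 0) : ∃ k, α ≤ i k := by
  by_contra! h
  obtain ⟨n, hn⟩ := Nat.exists_eq_succ_of_ne_zero hf
  have := forall_lt_abs_eval i h n f hn 0
  simp [hα] at this

theorem exists_ge_of_isRoot (i : K →+* R) (f : K[X]) (hf : f.natDegree ≠ 0) {α : R}
    (hα : (f.map i).eval α = 0) : ∃ k, i k ≤ α := by
  obtain ⟨k, hk⟩ := exists_le_of_isRoot i (f.comp (-X)) (α := -α)
    (by rw [natDegree_comp]; simpa using hf) (by rw [Polynomial.map_comp]; simpa using hα)
  exact ⟨-k, by rw [map_neg]; linarith⟩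

variable {S : Type} [Field S] [LinearOrder S] [IsStrictOrderedRing S]

theorem lt_iff_of_pos_iff {i : K →+* R} {j : K →+* S} (hij : ∀ x, 0 < i x ↔ 0 < j x) (x y : K) :
    i x < i y ↔ j x < j y := by
  have := hij (y - x)
  rwa [map_sub, map_sub, sub_pos, sub_pos] at this

theorem pos_eval_iff_of_same_cut (hR : PolyIVT R) (hS : PolyIVT S) {i : K →+* R} {j : K →+* S}
    (hij : ∀ x, 0 < i x ↔ 0 < j x) (h : K[X])
    (hiroot : ∀ x, (h.map i).eval x = 0 → ∃ k, i k = x)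
    (hjroot : ∀ x, (h.map j).eval x = 0 → ∃ k, j k = x) {α : R} {β : S}
    (hα : ∀ k, i k ≠ α) (hβ : ∀ k, j k ≠ β) (hcut : ∀ k, i k < α ↔ j k < β) :
    0 < (h.map i).eval α ↔ 0 < (h.map j).eval β := by
  classical
  by_cases h0 : h = 0
  · simp [h0]
  obtain ⟨m, hm⟩ := exists_mem_gap i h.roots.toFinset α hα
  have hmem : ∀ k, h.eval k = 0 → k ∈ h.roots.toFinset := fun k hk => by simp [h0, hk]
  have him : (h.map i).eval (i m) = i (h.eval m) := eval_map_apply ..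
  have hjm : (h.map j).eval (j m) = j (h.eval m) := eval_map_apply ..
  have hm0 : h.eval m ≠ 0 := fun hk => (hm m (hmem m hk)).2 rfl
  have e1 : 0 < (h.map i).eval α ↔ 0 < (h.map i).eval (i m) := by
    refine hR.pos_iff_pos _ (fun h' => ?_) (by rwa [him, _root_.map_ne_zero]) (fun c hc => ?_)
    · obtain ⟨k, hk⟩ := hiroot _ h'
      exact hα k hk
    · obtain ⟨k, rfl⟩ := hiroot _ hc
      refine (hm k (hmem k ?_)).1
      rwa [eval_map_apply, map_eq_zero] at hc
  have e2 : 0 < (h.map j).eval β ↔ 0 < (h.map j).eval (j m) := by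
    refine hS.pos_iff_pos _ (fun h' => ?_) (by rwa [hjm, _root_.map_ne_zero]) (fun c hc => ?_)
    · obtain ⟨k, hk⟩ := hjroot _ h'
      exact hβ k hk
    · obtain ⟨k, rfl⟩ := hjroot _ hc
      rw [← hcut, ← lt_iff_of_pos_iff hij]
      refine (hm k (hmem k ?_)).1
      rwa [eval_map_apply, map_eq_zero] at hc
  rw [e1, e2, him, hjm, hij]

/-- If all roots, in `R` and in `S`, of nonzero polynomials over `K` of degree less than `d`
lie in `K`, then a root in `R` of a polynomial of degree `d` has a counterpart in `S`. -/
theorem exists_conjugate_root (hR : PolyIVT R) (hS : PolyIVT S) {i : K →+* R} {j : K →+* S}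
    (hij : ∀ x, 0 < i x ↔ 0 < j x) (d : ℕ)
    (hiroot : ∀ h : K[X], h ≠ 0 → h.natDegree < d → ∀ x, (h.map i).eval x = 0 → ∃ k, i k = x)
    (hjroot : ∀ h : K[X], h ≠ 0 → h.natDegree < d → ∀ x, (h.map j).eval x = 0 → ∃ k, j k = x)
    (f : K[X]) (hf0 : f ≠ 0) (hfd : f.natDegree = d) {α : R} (hα : ∀ k, i k ≠ α)
    (hfα : (f.map i).eval α = 0) :
    ∃ β : S, ∀ h : K[X], 0 < (h.map i).eval α ↔ 0 < (h.map j).eval β := by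
  classical
  have hchar : CharZero K := i.charZero
  have hd0 : d ≠ 0 := by
    rintro rfl
    obtain ⟨c, rfl⟩ := natDegree_eq_zero.1 hfd
    simp at hfα
    simp [hfα] at hf0
  have hfk : ∀ k, f.eval k ≠ 0 := by
    intro k hk
    obtain ⟨g, hg⟩ := dvd_iff_isRoot.2 (show f.IsRoot k from hk)
    have hg0 : g ≠ 0 := by rintro rfl; simp [hg] at hf0
    have hgd : g.natDegree < d := by
      rw [← hfd, hg, natDegree_mul (X_sub_C_ne_zero k) hg0, natDegree_X_sub_C]
      omega
    rw [hg] at hfα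
    simp only [Polynomial.map_mul, Polynomial.map_sub, map_X, map_C, eval_mul, eval_sub, eval_X,
      eval_C, mul_eq_zero, sub_eq_zero] at hfα
    rcases hfα with h | h
    · exact hα k h.symm
    · obtain ⟨k', hk'⟩ := hiroot g hg0 hgd _ h
      exact hα k' hk'
  have hfi : ∀ k, (f.map i).eval (i k) ≠ 0 := fun k => by
    rw [eval_map_apply, _root_.map_ne_zero]; exact hfk k
  have hfj : ∀ k, (f.map j).eval (j k) ≠ 0 := fun k => by
    rw [eval_map_apply, _root_.map_ne_zero]; exact hfk k
  have hder0 : derivative f ≠ 0 := fun h => hd0 (hfd ▸ derivative_eq_zero.1 h)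
  have hderd : (derivative f).natDegree < d := hfd ▸ natDegree_derivative_lt (hfd ▸ hd0)
  obtain ⟨q₀, hq₀⟩ := exists_le_of_isRoot i f (hfd ▸ hd0) hfα
  obtain ⟨p₀, hp₀⟩ := exists_ge_of_isRoot i f (hfd ▸ hd0) hfα
  obtain ⟨p, q, hpq, hA, hB, hp, hq⟩ :=
    exists_adjacent i ({p₀, q₀} ∪ (derivative f).roots.toFinset) α
  replace hp := hp ⟨p₀, by simp, lt_of_le_of_ne hp₀ (hα _)⟩
  replace hq := hq ⟨q₀, by simp, lt_of_le_of_ne hq₀ (hα _).symm⟩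
  have hmem : ∀ k, (derivative f).eval k = 0 → ¬ (i p < i k ∧ i k < i q) := by
    rintro k hk ⟨h1, h2⟩
    have hkm : k ∈ {p₀, q₀} ∪ (derivative f).roots.toFinset := by simp [hder0, hk]
    rcases lt_or_gt_of_ne (hα k) with h | h
    · exact absurd (hA k hkm h) h1.not_ge
    · exact absurd (hB k hkm h) h2.not_ge
  have hlt := lt_iff_of_pos_iff hij
  have hci : ∀ c, i p < c → c < i q → (derivative (f.map i)).eval c ≠ 0 := by
    intro c h1 h2 hc
    rw [derivative_map] at hc
    obtain ⟨k, rfl⟩ := hiroot _ hder0 hderd _ hc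
    rw [eval_map_apply, map_eq_zero] at hc
    exact hmem k hc ⟨h1, h2⟩
  have hcj : ∀ c, j p < c → c < j q → (derivative (f.map j)).eval c ≠ 0 := by
    intro c h1 h2 hc
    rw [derivative_map] at hc
    obtain ⟨k, rfl⟩ := hjroot _ hder0 hderd _ hc
    rw [eval_map_apply, map_eq_zero] at hc
    exact hmem k hc ⟨(hlt _ _).2 h1, (hlt _ _).2 h2⟩
  have hneg : ∀ x y, (f.map i).eval (i x) * (f.map i).eval (i y) < 0 ↔
      (f.map j).eval (j x) * (f.map j).eval (j y) < 0 := by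
    intro x y
    simp only [eval_map_apply, ← map_mul]
    simpa using hlt (f.eval x * f.eval y) 0
  have hfpq := hR.mul_neg_of_root _ hp hq (hfi p) (hfi q) hfα hci
  obtain ⟨β, hpβ, hβq, hfβ⟩ := hS _ _ _ ((hlt _ _).1 hpq) ((hneg _ _).1 hfpq)
  have hβ : ∀ k, j k ≠ β := by rintro k rfl; exact hfj k hfβ
  have hcut : ∀ k, i k < α ↔ j k < β := by
    intro k
    by_cases h1 : i p < i k
    · by_cases h2 : i k < i q
      · rw [hR.lt_root_iff _ hp hq (hfi p) (hfi q) hfα hci h1 h2 (hfi k), hneg,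
          hS.lt_root_iff _ hpβ hβq (hfj p) (hfj q) hfβ hcj ((hlt _ _).1 h1) ((hlt _ _).1 h2)
            (hfj k)]
      · have h3 : ¬ j k < j q := by rwa [← hlt]
        exact ⟨fun h => absurd (h.trans hq) h2, fun h => absurd (h.trans hβq) h3⟩
    · have h3 : ¬ j p < j k := by rwa [← hlt]
      exact ⟨fun _ => (not_lt.1 h3).trans_lt hpβ, fun _ => (not_lt.1 h1).trans_lt hp⟩
  refine ⟨β, fun h => ?_⟩
  have hα' : (h.map i).eval α = ((h % f).map i).eval α := by
    conv_lhs => rw [← EuclideanDomain.div_add_mod h f]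
    simp [hfα]
  have hβ' : (h.map j).eval β = ((h % f).map j).eval β := by
    conv_lhs => rw [← EuclideanDomain.div_add_mod h f]
    simp [hfβ]
  rw [hα', hβ']
  by_cases h0 : h % f = 0
  · simp [h0]
  have hdeg : (h % f).natDegree < d := hfd ▸ natDegree_mod_lt h (hfd ▸ hd0)
  exact pos_eval_iff_of_same_cut hR hS hij _ (hiroot _ h0 hdeg) (hjroot _ h0 hdeg) hα hβ hcut

end Polynomial

namespace Polynomial

variable {A R S : Type} [CommRing A] [Field R] [LinearOrder R] [IsStrictOrderedRing R]
  [Field S] [LinearOrder S] [IsStrictOrderedRing S]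

theorem eq_zero_iff_of_pos_iff (Γ : Subring (R × S)) (hΓ : ∀ w ∈ Γ, 0 < w.1 ↔ 0 < w.2)
    {w : R × S} (hw : w ∈ Γ) : w.1 = 0 ↔ w.2 = 0 := by
  have h1 := hΓ w hw
  have h2 := hΓ (-w) (Γ.neg_mem hw)
  simp only [Prod.fst_neg, Prod.snd_neg, Left.neg_pos_iff] at h2
  constructor
  · intro h
    exact le_antisymm (not_lt.1 fun h' => (h1.2 h').ne' h) (not_lt.1 fun h' => (h2.2 h').ne h)
  · intro h
    exact le_antisymm (not_lt.1 fun h' => (h1.1 h').ne' h) (not_lt.1 fun h' => (h2.1 h').ne h)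

/-- A subring of `R × S` maximal among those with matching signs in both coordinates is closed
under inversion. -/
theorem inv_mem_of_maximal {Γ₀ Γ : Subring (R × S)}
    (hΓ : Maximal (fun Γ => Γ₀ ≤ Γ ∧ ∀ w ∈ Γ, 0 < w.1 ↔ 0 < w.2) Γ)
    {w : R × S} (hw : w ∈ Γ) (hw0 : w ≠ 0) : w * w⁻¹ = 1 ∧ w⁻¹ ∈ Γ := by
  have hz := eq_zero_iff_of_pos_iff Γ hΓ.prop.2 hw
  have h1 : w.1 ≠ 0 := fun h => hw0 (Prod.ext h (hz.1 h))
  have h2 : w.2 ≠ 0 := fun h => hw0 (Prod.ext (hz.2 h) h)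
  have hinv : w * w⁻¹ = 1 := Prod.ext (mul_inv_cancel₀ h1) (mul_inv_cancel₀ h2)
  refine ⟨hinv, ?_⟩
  let Δ : Subring (R × S) :=
    { carrier := {u | ∃ s ∈ Γ, s.1 ≠ 0 ∧ s.2 ≠ 0 ∧ s * u ∈ Γ}
      mul_mem' := by
        rintro a b ⟨s, hs, hs1, hs2, hsa⟩ ⟨t, ht, ht1, ht2, htb⟩
        refine ⟨s * t, Γ.mul_mem hs ht, mul_ne_zero hs1 ht1, mul_ne_zero hs2 ht2, ?_⟩
        rw [mul_mul_mul_comm]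
        exact Γ.mul_mem hsa htb
      one_mem' := ⟨1, Γ.one_mem, one_ne_zero, one_ne_zero, by simp⟩
      add_mem' := by
        rintro a b ⟨s, hs, hs1, hs2, hsa⟩ ⟨t, ht, ht1, ht2, htb⟩
        refine ⟨s * t, Γ.mul_mem hs ht, mul_ne_zero hs1 ht1, mul_ne_zero hs2 ht2, ?_⟩
        have : s * t * (a + b) = t * (s * a) + s * (t * b) := by ring
        rw [this]
        exact Γ.add_mem (Γ.mul_mem ht hsa) (Γ.mul_mem hs htb)
      zero_mem' := ⟨1, Γ.one_mem, one_ne_zero, one_ne_zero, by simp⟩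
      neg_mem' := by
        rintro a ⟨s, hs, hs1, hs2, hsa⟩
        exact ⟨s, hs, hs1, hs2, by simpa using Γ.neg_mem hsa⟩ }
  have hΓΔ : Γ ≤ Δ := fun u hu => ⟨1, Γ.one_mem, one_ne_zero, one_ne_zero, by simpa using hu⟩
  have hΔ : ∀ u ∈ Δ, 0 < u.1 ↔ 0 < u.2 := by
    rintro u ⟨s, hs, hs1, hs2, hsu⟩
    have := hΓ.prop.2 _ (Γ.mul_mem hs hsu)
    simp only [Prod.fst_mul, Prod.snd_mul, ← mul_assoc] at this
    rwa [mul_pos_iff_of_pos_left (mul_self_pos.2 hs1),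
      mul_pos_iff_of_pos_left (mul_self_pos.2 hs2)] at this
  exact hΓ.le_of_ge ⟨hΓ.prop.1.trans hΓΔ, hΔ⟩ hΓΔ ⟨w, hw, h1, h2, hinv ▸ Γ.one_mem⟩

theorem exists_maximal_common_field (φ : A →+* R) (χ : A →+* S)
    (hφχ : ∀ a, 0 < φ a ↔ 0 < χ a) :
    ∃ (K : Type) (_ : Field K) (i : K →+* R) (j : K →+* S) (π : A →+* K),
      (∀ a, i (π a) = φ a) ∧ (∀ a, j (π a) = χ a) ∧ (∀ x, 0 < i x ↔ 0 < j x) ∧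
      ∀ α β, (∀ h : K[X], 0 < (h.map i).eval α ↔ 0 < (h.map j).eval β) →
        ∃ k, i k = α ∧ j k = β := by
  obtain ⟨Γ, -, hΓ⟩ := zorn_le_nonempty₀
    {Γ : Subring (R × S) | (φ.prod χ).range ≤ Γ ∧ ∀ w ∈ Γ, 0 < w.1 ↔ 0 < w.2} (by
      rintro c hc hchain Γ₁ hΓ₁
      refine ⟨sSup c, ⟨(hc hΓ₁).1.trans (le_sSup hΓ₁), fun w hw => ?_⟩, fun z hz => le_sSup hz⟩
      obtain ⟨Γ₂, h2, hw2⟩ := (Subring.mem_sSup_of_directedOn ⟨Γ₁, hΓ₁⟩ hchain.directedOn).1 hw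
      exact (hc h2).2 w hw2) (φ.prod χ).range
    ⟨le_rfl, by rintro _ ⟨a, rfl⟩; exact hφχ a⟩
  have hfield : IsField Γ :=
    { exists_pair_ne := ⟨0, 1, zero_ne_one⟩
      mul_comm := mul_comm
      mul_inv_cancel := fun {a} ha =>
        have h := inv_mem_of_maximal hΓ a.2 (fun h => ha (Subtype.ext h))
        ⟨⟨_, h.2⟩, Subtype.ext h.1⟩ }
  let := hfield.toField
  let i : Γ →+* R := (RingHom.fst R S).comp Γ.subtype
  let j : Γ →+* S := (RingHom.snd R S).comp Γ.subtype
  refine ⟨Γ, inferInstance, i, j,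
    (φ.prod χ).codRestrict Γ fun a => hΓ.prop.1 ⟨a, rfl⟩, fun _ => rfl, fun _ => rfl,
    fun x => hΓ.prop.2 x x.2, fun α β hαβ => ?_⟩
  let ev : Γ[X] →+* R × S := (eval₂RingHom i α).prod (eval₂RingHom j β)
  have hle : Γ ≤ ev.range := fun w hw => ⟨C ⟨w, hw⟩, by simp [ev, i, j]⟩
  have hmem : ((α, β) : R × S) ∈ Γ := by
    refine hΓ.le_of_ge ⟨hΓ.prop.1.trans hle, ?_⟩ hle ⟨X, by simp [ev]⟩
    rintro _ ⟨h, rfl⟩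
    have := hαβ h
    rwa [eval_map, eval_map] at this
  exact ⟨⟨_, hmem⟩, rfl, rfl⟩

/-- One-variable transfer between ordered fields with the intermediate value property. -/
theorem exists_forall_pos_eval_iff (hR : PolyIVT R) (hS : PolyIVT S) (φ : A →+* R) (χ : A →+* S)
    (hφχ : ∀ a, 0 < φ a ↔ 0 < χ a) (H : Finset A[X]) (y : R) :
    ∃ z : S, ∀ h ∈ H, 0 < (h.map φ).eval y ↔ 0 < (h.map χ).eval z := by
  classical
  obtain ⟨K, _, i, j, π, hiπ, hjπ, hij, hmax⟩ := exists_maximal_common_field φ χ hφχ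
  have hroot : ∀ d : ℕ, ∀ f : K[X], f ≠ 0 → f.natDegree = d →
      (∀ x, (f.map i).eval x = 0 → ∃ k, i k = x) ∧ ∀ x, (f.map j).eval x = 0 → ∃ k, j k = x := by
    intro d
    induction d using Nat.strong_induction_on with
    | _ d ih =>
      intro f hf0 hfd
      constructor
      · intro α hα
        by_contra! hcon
        obtain ⟨β, hβ⟩ := exists_conjugate_root hR hS hij d
          (fun h h0 hd => (ih _ hd h h0 rfl).1) (fun h h0 hd => (ih _ hd h h0 rfl).2)
          f hf0 hfd hcon hα
        obtain ⟨k, hk, -⟩ := hmax α β hβ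
        exact hcon k hk
      · intro β hβ
        by_contra! hcon
        obtain ⟨α, hα⟩ := exists_conjugate_root hS hR (fun x => (hij x).symm) d
          (fun h h0 hd => (ih _ hd h h0 rfl).2) (fun h h0 hd => (ih _ hd h h0 rfl).1)
          f hf0 hfd hcon hβ
        obtain ⟨k, -, hk⟩ := hmax α β fun h => (hα h).symm
        exact hcon k hk
  have hi : i.comp π = φ := RingHom.ext hiπ
  have hj : j.comp π = χ := RingHom.ext hjπ
  have hkey : ∃ m : K, ∀ h ∈ H, 0 < (h.map φ).eval y ↔ 0 < ((h.map π).map i).eval (i m) := by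
    by_cases hy : ∃ k, i k = y
    · obtain ⟨k, rfl⟩ := hy
      exact ⟨k, fun h _ => by rw [Polynomial.map_map, hi]⟩
    · push Not at hy
      obtain ⟨m, hm⟩ := exists_mem_gap i (H.biUnion fun h => (h.map π).roots.toFinset) y hy
      refine ⟨m, fun h hh => ?_⟩
      rw [← hi, ← Polynomial.map_map]
      by_cases h0 : h.map π = 0
      · simp [h0]
      have hmem : ∀ k, ((h.map π).map i).eval (i k) = 0 →
          k ∈ H.biUnion fun h => (h.map π).roots.toFinset := fun k hk => by
        rw [eval_map_apply, map_eq_zero] at hk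
        exact Finset.mem_biUnion.2 ⟨h, hh, by simpa [h0] using hk⟩
      refine hR.pos_iff_pos _ (fun h' => ?_) (fun h' => (hm m (hmem m h')).2 rfl) fun c hc => ?_
      · obtain ⟨k, hk⟩ := (hroot _ _ h0 rfl).1 _ h'
        exact hy k hk
      · obtain ⟨k, rfl⟩ := (hroot _ _ h0 rfl).1 _ hc
        exact (hm k (hmem k hc)).1
  obtain ⟨m, hm⟩ := hkey
  refine ⟨j m, fun h hh => ?_⟩
  rw [hm h hh, ← hj, ← Polynomial.map_map, eval_map_apply, eval_map_apply, hij]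

end Polynomial

namespace Filter.Germ

variable {α : Type}

theorem eval_map_coeRingHom {l : Filter α} (f : Polynomial (α → ℝ)) (a : α → ℝ) :
    (f.map (coeRingHom l)).eval (a : Germ l ℝ) =
      ((fun x => (f.map (Pi.evalRingHom _ x)).eval (a x) : α → ℝ) : Germ l ℝ) := by
  rw [← coe_coeRingHom, Polynomial.eval_map_apply]
  refine congrArg _ (funext fun x => ?_)
  exact (Polynomial.eval_map_apply (f := Pi.evalRingHom (fun _ => ℝ) x) (p := f) a).symm

/-- Ultrapowers of the real field have the intermediate value property for polynomials. -/
theorem polyIVT (l : Ultrafilter α) : PolyIVT (Germ (l : Filter α) ℝ) := by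
  intro f a b hab hf
  obtain ⟨f, rfl⟩ := Polynomial.map_surjective (coeRingHom (l : Filter α))
    (fun g => g.inductionOn fun g => ⟨g, rfl⟩) f
  induction a using Germ.inductionOn with | _ a
  induction b using Germ.inductionOn with | _ b
  rw [eval_map_coeRingHom, eval_map_coeRingHom, ← coe_mul] at hf
  have hex : ∀ x, ∃ c, a x < b x → (f.map (Pi.evalRingHom _ x)).eval (a x) *
      (f.map (Pi.evalRingHom _ x)).eval (b x) < 0 →
      a x < c ∧ c < b x ∧ (f.map (Pi.evalRingHom _ x)).eval c = 0 := by
    intro x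
    by_cases h : a x < b x ∧ (f.map (Pi.evalRingHom _ x)).eval (a x) *
      (f.map (Pi.evalRingHom _ x)).eval (b x) < 0
    · obtain ⟨h1, h2⟩ := h
      set g := f.map (Pi.evalRingHom (fun _ => ℝ) x)
      obtain ⟨c, hc, hc0⟩ : (0 : ℝ) ∈ (fun t => g.eval t) '' Set.uIcc (a x) (b x) :=
        intermediate_value_uIcc g.continuous.continuousOn (by
          rw [Set.mem_uIcc]
          rcases mul_neg_iff.1 h2 with h | h
          · exact Or.inr ⟨h.2.le, h.1.le⟩
          · exact Or.inl ⟨h.1.le, h.2.le⟩)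
      rw [Set.uIcc_of_le h1.le] at hc
      refine ⟨c, fun _ _ => ⟨lt_of_le_of_ne hc.1 ?_, lt_of_le_of_ne hc.2 ?_, hc0⟩⟩
      · rintro rfl
        simp only at hc0
        simp [hc0] at h2
      · rintro rfl
        simp only at hc0
        simp [hc0] at h2
    · exact ⟨0, fun h1 h2 => (h ⟨h1, h2⟩).elim⟩
  choose c hc using hex
  have hev : ∀ᶠ x in (l : Filter α), a x < c x ∧ c x < b x ∧
      (f.map (Pi.evalRingHom _ x)).eval (c x) = 0 := by
    filter_upwards [coe_lt.1 hab, coe_lt.1 hf] with x h1 h2 using hc x h1 h2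
  refine ⟨c, coe_lt.2 (hev.mono fun x h => h.1), coe_lt.2 (hev.mono fun x h => h.2.1), ?_⟩
  rw [eval_map_coeRingHom]
  exact coe_eq.2 (hev.mono fun x h => h.2.2)

end Filter.Germ

namespace MvPolynomial

variable {R : Type} [Field R] [LinearOrder R] [IsStrictOrderedRing R]

theorem _root_.RingHom.pos_iff_of_real (ι : ℝ →+* R) (x : ℝ) : 0 < ι x ↔ 0 < x := by
  have key : ∀ x, 0 < x → 0 < ι x := fun x hx => by
    rw [← Real.mul_self_sqrt hx.le, map_mul]
    exact mul_self_pos.2 ((_root_.map_ne_zero ι).2 (Real.sqrt_pos.2 hx).ne')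
  refine ⟨fun h => ?_, key x⟩
  by_contra! hx
  rcases hx.lt_or_eq with hx | rfl
  · have := key (-x) (neg_pos.2 hx)
    rw [map_neg] at this
    linarith
  · simp at h

/-- The sign pattern of finitely many polynomials at a point of an extension of the real field
with the intermediate value property is realized at a real point. -/
theorem exists_forall_pos_eval_iff_fin (hR : PolyIVT R) :
    ∀ (k : ℕ) (ψ : MvPolynomial (Fin k) ℝ →+* R) (H : Finset (MvPolynomial (Fin k) ℝ)),
      ∃ b : Fin k → ℝ, ∀ h ∈ H, 0 < ψ h ↔ 0 < eval b h := by
  intro k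
  induction k with
  | zero =>
    intro ψ H
    refine ⟨Fin.elim0, fun h _ => ?_⟩
    obtain ⟨c, rfl⟩ := C_surjective (Fin 0) h
    rw [eval_C]
    exact (ψ.comp C).pos_iff_of_real c
  | succ k ih =>
    intro ψ H
    classical
    set e := finSuccEquiv ℝ k
    let ψ' : Polynomial (MvPolynomial (Fin k) ℝ) →+* R := ψ.comp e.symm
    let φ : MvPolynomial (Fin k) ℝ →+* R := ψ'.comp Polynomial.C
    have hψ : ∀ h, ((e h).map φ).eval (ψ' Polynomial.X) = ψ h := by
      intro h
      have h1 : Polynomial.eval₂RingHom φ (ψ' Polynomial.X) = ψ' :=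
        Polynomial.ringHom_ext (fun a => by simp [φ]) (by simp)
      rw [Polynomial.eval_map, ← Polynomial.coe_eval₂RingHom, h1]
      simp [ψ']
    choose b hb using ih φ
    let l : Ultrafilter (Finset (MvPolynomial (Fin k) ℝ)) := Ultrafilter.of atTop
    let χ : MvPolynomial (Fin k) ℝ →+* Germ (l : Filter (Finset (MvPolynomial (Fin k) ℝ))) ℝ :=
      (Germ.coeRingHom _).comp (RingHom.pi fun G => eval (b G))
    have hφχ : ∀ h, 0 < φ h ↔ 0 < χ h := by
      intro h
      have hev : ∀ᶠ G in (l : Filter (Finset (MvPolynomial (Fin k) ℝ))),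
          0 < φ h ↔ 0 < eval (b G) h :=
        Ultrafilter.of_le atTop ((eventually_ge_atTop {h}).mono fun G hG => hb G h (hG (by simp)))
      change _ ↔ 0 < Germ.ofFun (l := (l : Filter (Finset (MvPolynomial (Fin k) ℝ)))) fun G => eval (b G) h
      rw [Germ.coe_pos, ← eventually_congr hev, eventually_const]
    obtain ⟨z, hz⟩ := Polynomial.exists_forall_pos_eval_iff hR (Germ.polyIVT l) φ χ hφχ
      (H.image e) (ψ' Polynomial.X)
    induction z using Germ.inductionOn with | _ z
    have hev : ∀ᶠ G in (l : Filter (Finset (MvPolynomial (Fin k) ℝ))), ∀ h ∈ H,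
        0 < ψ h ↔ 0 < eval (Fin.cons (z G) (b G) : Fin (k + 1) → ℝ) h := by
      rw [Filter.eventually_all_finset]
      intro h hh
      have h1 := hz (e h) (Finset.mem_image_of_mem e hh)
      rw [hψ, ← Polynomial.map_map, Germ.eval_map_coeRingHom, Germ.coe_pos] at h1
      have h2 : ∀ G, (((e h).map (RingHom.pi fun G => eval (b G))).map
          (Pi.evalRingHom (fun _ => ℝ) G)).eval (z G) =
          eval (Fin.cons (z G) (b G) : Fin (k + 1) → ℝ) h := fun G => by
        rw [eval_eq_eval_mv_eval', Polynomial.map_map]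
        rfl
      simp only [h2] at h1
      by_cases hpos : 0 < ψ h
      · exact (h1.1 hpos).mono fun G hG => ⟨fun _ => hG, fun _ => hpos⟩
      · have := Ultrafilter.eventually_not.2 (fun h => hpos (h1.2 h))
        exact this.mono fun G hG => ⟨fun h => (hpos h).elim, fun h => (hG h).elim⟩
    obtain ⟨G, hG⟩ := hev.exists
    exact ⟨_, hG⟩

theorem exists_forall_pos_eval_iff {τ : Type} [Fintype τ] (hR : PolyIVT R)
    (ψ : MvPolynomial τ ℝ →+* R) (H : Finset (MvPolynomial τ ℝ)) :
    ∃ b : τ → ℝ, ∀ h ∈ H, 0 < ψ h ↔ 0 < eval b h := by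
  classical
  let e := Fintype.equivFin τ
  obtain ⟨b, hb⟩ := exists_forall_pos_eval_iff_fin hR _
    (ψ.comp (rename e.symm : MvPolynomial _ ℝ →ₐ[ℝ] MvPolynomial τ ℝ).toRingHom)
    (H.image (rename e))
  refine ⟨b ∘ e, fun h hh => ?_⟩
  have := hb _ (Finset.mem_image_of_mem _ hh)
  rw [eval_rename] at this
  rw [← this]
  simp [rename_rename]

end MvPolynomial

/-- A quadratic module of a commutative ring. -/
structure IsQuadraticModule {A : Type} [CommRing A] (Q : Set A) : Prop where
  one_mem : 1 ∈ Q
  add_mem : ∀ {a b}, a ∈ Q → b ∈ Q → a + b ∈ Q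
  sq_mul_mem : ∀ (a) {q}, q ∈ Q → a ^ 2 * q ∈ Q

namespace IsQuadraticModule

variable {A : Type} [CommRing A] {Q : Set A}

theorem sq_mem (hQ : IsQuadraticModule Q) (a : A) : a ^ 2 ∈ Q := by
  simpa using hQ.sq_mul_mem a hQ.one_mem

theorem zero_mem (hQ : IsQuadraticModule Q) : 0 ∈ Q := by simpa using hQ.sq_mem 0

theorem sum_mem (hQ : IsQuadraticModule Q) {ι : Type} (s : Finset ι) (f : ι → A)
    (hf : ∀ i ∈ s, f i ∈ Q) : ∑ i ∈ s, f i ∈ Q :=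
  Finset.sum_induction f (· ∈ Q) (fun _ _ => hQ.add_mem) hQ.zero_mem hf

theorem isSumSq_mul_mem (hQ : IsQuadraticModule Q) {s q : A} (hs : IsSumSq s) (hq : q ∈ Q) :
    s * q ∈ Q := by
  induction hs using IsSumSq.rec' with
  | zero => simpa using hQ.zero_mem
  | sq_add hx _ ih =>
    obtain ⟨a, rfl⟩ := hx
    rw [add_mul, ← pow_two]
    exact hQ.add_mem (hQ.sq_mul_mem a hq) ih

theorem of_subsemiring (M : Subsemiring A) (hM : ∀ a, a ^ 2 ∈ M) :
    IsQuadraticModule (M : Set A) where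
  one_mem := M.one_mem
  add_mem := M.add_mem
  sq_mul_mem a _ hq := M.mul_mem (hM a) hq

/-- The set `Q + M p`. -/
theorem add_mul {M : Subsemiring A} (hM : ∀ a, a ^ 2 ∈ M) (hQ : IsQuadraticModule Q) (p : A) :
    IsQuadraticModule {x | ∃ q ∈ Q, ∃ m ∈ M, x = q + m * p} where
  one_mem := ⟨1, hQ.one_mem, 0, M.zero_mem, by simp⟩
  add_mem := by
    rintro _ _ ⟨q, hq, m, hm, rfl⟩ ⟨q', hq', m', hm', rfl⟩
    exact ⟨q + q', hQ.add_mem hq hq', m + m', M.add_mem hm hm', by ring⟩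
  sq_mul_mem := by
    rintro a _ ⟨q, hq, m, hm, rfl⟩
    exact ⟨a ^ 2 * q, hQ.sq_mul_mem a hq, a ^ 2 * m, M.mul_mem (hM a) hm, by ring⟩

end IsQuadraticModule

/-- The subsemiring `M + M p`, for `M` containing all squares. -/
def Subsemiring.addMul {A : Type} [CommRing A] (M : Subsemiring A) (hM : ∀ a, a ^ 2 ∈ M) (p : A) :
    Subsemiring A where
  carrier := {x | ∃ q ∈ M, ∃ m ∈ M, x = q + m * p}
  zero_mem' := ⟨0, M.zero_mem, 0, M.zero_mem, by simp⟩
  one_mem' := ⟨1, M.one_mem, 0, M.zero_mem, by simp⟩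
  add_mem' := by
    rintro _ _ ⟨q, hq, m, hm, rfl⟩ ⟨q', hq', m', hm', rfl⟩
    exact ⟨q + q', M.add_mem hq hq', m + m', M.add_mem hm hm', by ring⟩
  mul_mem' := by
    rintro _ _ ⟨q, hq, m, hm, rfl⟩ ⟨q', hq', m', hm', rfl⟩
    exact ⟨q * q' + p ^ 2 * (m * m'),
      M.add_mem (M.mul_mem hq hq') (M.mul_mem (hM p) (M.mul_mem hm hm')), q * m' + m * q',
      M.add_mem (M.mul_mem hq hm') (M.mul_mem hm hq'), by ring⟩

theorem Subsemiring.mem_addMul {A : Type} [CommRing A] {M : Subsemiring A}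
    {hM : ∀ a, a ^ 2 ∈ M} {p x : A} : x ∈ M.addMul hM p ↔ ∃ q ∈ M, ∃ m ∈ M, x = q + m * p :=
  Iff.rfl

theorem Subsemiring.le_addMul {A : Type} [CommRing A] (M : Subsemiring A)
    (hM : ∀ a, a ^ 2 ∈ M) (p : A) : M ≤ M.addMul hM p :=
  fun x hx => ⟨x, hx, 0, M.zero_mem, by simp⟩

theorem Subsemiring.self_mem_addMul {A : Type} [CommRing A] (M : Subsemiring A)
    (hM : ∀ a, a ^ 2 ∈ M) (p : A) : p ∈ M.addMul hM p :=
  ⟨0, M.zero_mem, 1, M.one_mem, by simp⟩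

namespace MvPolynomial

variable {τ : Type}

/-- Krivine's certificate for a polynomial `g` that is positive wherever `P` is nonnegative. -/
theorem exists_mul_eq_one_add [Fintype τ] (P g : MvPolynomial τ ℝ) (M : Subsemiring (MvPolynomial τ ℝ))
    (hM : ∀ a, a ^ 2 ∈ M) (hP : P ∈ M) (hg : ∀ z, 0 ≤ eval z P → 0 < eval z g) :
    ∃ s ∈ M, ∃ t ∈ M, s * g = 1 + t := by
  by_contra! hcon
  have hneg : -1 ∉ M.addMul hM (-g) := by
    rintro ⟨q, hq, m, hm, h⟩
    exact hcon m hm q hq (by linear_combination h)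
  obtain ⟨R, _, _, _, hR, ψ, hψ⟩ := RingPreordering.exists_ringHom_polyIVT
    (RingPreordering.mk' (M.addMul hM (-g) : Set (MvPolynomial τ ℝ)) add_mem mul_mem
      (fun x => M.le_addMul hM _ (pow_two x ▸ hM x)) hneg)
  classical
  obtain ⟨b, hb⟩ := exists_forall_pos_eval_iff hR ψ {-P, g}
  have h1 := hb (-P) (by simp)
  have h2 := hb g (by simp)
  have h3 := hψ P (M.le_addMul hM _ hP)
  have h4 := hψ (-g) (M.self_mem_addMul hM _)
  simp only [map_neg, Left.neg_pos_iff, Left.nonneg_neg_iff] at h1 h4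
  have h5 : 0 ≤ eval b P := not_lt.1 fun h => (h1.2 h).not_ge h3
  exact (h2.2 (hg b h5)).not_ge h4

end MvPolynomial

namespace IsQuadraticModule

variable {τ : Type} {Q : Set (MvPolynomial τ ℝ)}

theorem C_mul_mem (hQ : IsQuadraticModule Q) {r : ℝ} (hr : 0 ≤ r) {q : MvPolynomial τ ℝ}
    (hq : q ∈ Q) : C r * q ∈ Q := by
  have := hQ.sq_mul_mem (C √r) hq
  rwa [← C_pow, Real.sq_sqrt hr] at this

theorem C_mem (hQ : IsQuadraticModule Q) {r : ℝ} (hr : 0 ≤ r) : C r ∈ Q := by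
  simpa using hQ.C_mul_mem hr hQ.one_mem

theorem mem_of_C_mul_mem (hQ : IsQuadraticModule Q) {r : ℝ} (hr : 0 < r) {q : MvPolynomial τ ℝ}
    (hq : C r * q ∈ Q) : q ∈ Q := by
  have := hQ.C_mul_mem (inv_pos.2 hr).le hq
  rwa [← mul_assoc, ← C_mul, inv_mul_cancel₀ hr.ne', C_1, one_mul] at this

/-- Elements bounded, up to sign, by a constant with respect to a quadratic module. -/
def Bounded (Q : Set (MvPolynomial τ ℝ)) (a : MvPolynomial τ ℝ) : Prop :=
  ∃ k : ℝ, 0 < k ∧ C k - a ∈ Q ∧ C k + a ∈ Q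

theorem bounded_C (hQ : IsQuadraticModule Q) (r : ℝ) : Bounded Q (C r) :=
  ⟨|r| + 1, by positivity, by rw [← C_sub]; exact hQ.C_mem (by linarith [le_abs_self r]),
    by rw [← C_add]; exact hQ.C_mem (by linarith [neg_abs_le r])⟩

theorem Bounded.add (hQ : IsQuadraticModule Q) {a b : MvPolynomial τ ℝ} (ha : Bounded Q a)
    (hb : Bounded Q b) : Bounded Q (a + b) := by
  obtain ⟨k, hk, h1, h2⟩ := ha
  obtain ⟨l, hl, h3, h4⟩ := hb
  refine ⟨k + l, by positivity, ?_, ?_⟩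
  · convert hQ.add_mem h1 h3 using 1
    rw [C_add]; ring
  · convert hQ.add_mem h2 h4 using 1
    rw [C_add]; ring

theorem Bounded.C_mul (hQ : IsQuadraticModule Q) {a : MvPolynomial τ ℝ} (ha : Bounded Q a)
    (r : ℝ) : Bounded Q (C r * a) := by
  obtain ⟨k, hk, h1, h2⟩ := ha
  rcases le_total 0 r with hr | hr
  · refine ⟨(r + 1) * k, by positivity, ?_, ?_⟩
    · convert hQ.add_mem (hQ.C_mul_mem hr h1) (hQ.C_mem hk.le) using 1
      simp only [map_mul, map_add, map_one]; ring
    · convert hQ.add_mem (hQ.C_mul_mem hr h2) (hQ.C_mem hk.le) using 1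
      simp only [map_mul, map_add, map_one]; ring
  · have hr' := neg_nonneg.2 hr
    refine ⟨(-r + 1) * k, by positivity, ?_, ?_⟩
    · convert hQ.add_mem (hQ.C_mul_mem hr' h2) (hQ.C_mem hk.le) using 1
      simp only [map_mul, map_add, map_one, map_neg]; ring
    · convert hQ.add_mem (hQ.C_mul_mem hr' h1) (hQ.C_mem hk.le) using 1
      simp only [map_mul, map_add, map_one, map_neg]; ring

theorem C_sq_sub_sq_mem (hQ : IsQuadraticModule Q) {a : MvPolynomial τ ℝ} {k : ℝ} (hk : 0 < k)
    (h1 : C k - a ∈ Q) (h2 : C k + a ∈ Q) : C (k ^ 2) - a ^ 2 ∈ Q := by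
  refine hQ.mem_of_C_mul_mem (r := 2 * k) (by positivity) ?_
  convert hQ.add_mem (hQ.sq_mul_mem (C k + a) h1) (hQ.sq_mul_mem (C k - a) h2) using 1
  simp only [map_mul, map_pow, map_ofNat]; ring

theorem Bounded.sq (hQ : IsQuadraticModule Q) {a : MvPolynomial τ ℝ} (ha : Bounded Q a) :
    Bounded Q (a ^ 2) := by
  obtain ⟨k, hk, h1, h2⟩ := ha
  exact ⟨k ^ 2, by positivity, hQ.C_sq_sub_sq_mem hk h1 h2,
    hQ.add_mem (hQ.C_mem (by positivity)) (hQ.sq_mem a)⟩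

theorem Bounded.mul (hQ : IsQuadraticModule Q) {a b : MvPolynomial τ ℝ} (ha : Bounded Q a)
    (hb : Bounded Q b) : Bounded Q (a * b) := by
  have h : a * b = C (1 / 4) * ((a + b) ^ 2 + C (-1) * (a + C (-1) * b) ^ 2) := by
    have : (C (1 / 4) : MvPolynomial τ ℝ) * 4 = 1 := by
      rw [← map_ofNat C, ← MvPolynomial.C_mul]
      norm_num
    simp only [map_neg, map_one]
    linear_combination (-a * b) * this
  rw [h]
  exact ((ha.add hQ hb).sq hQ |>.add hQ (((ha.add hQ (hb.C_mul hQ _)).sq hQ).C_mul hQ _)).C_mul hQ _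

theorem bounded_of_C_sub_sum_sq_mem [Fintype τ] (hQ : IsQuadraticModule Q) {N : ℝ}
    (hN : C N - ∑ i, X i ^ 2 ∈ Q) (a : MvPolynomial τ ℝ) : Bounded Q a := by
  classical
  have hX : ∀ i, Bounded Q (X i) := by
    intro i
    have h1 : C N - X i ^ 2 ∈ Q := by
      convert hQ.add_mem hN (hQ.sum_mem (Finset.univ.erase i) _ fun j _ => hQ.sq_mem (X j)) using 1
      rw [← Finset.add_sum_erase Finset.univ _ (Finset.mem_univ i)]
      ring
    have h2 : (C (1 / 4) : MvPolynomial τ ℝ) = C (1 / 2) ^ 2 := by rw [← C_pow]; norm_num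
    have h3 : (C (1 / 2) : MvPolynomial τ ℝ) * 2 = 1 := by
      rw [← map_ofNat C, ← MvPolynomial.C_mul]
      norm_num
    have hk : C (|N| + 1 / 4) = C (|N| - N) + (C N + C (1 / 4) : MvPolynomial τ ℝ) := by
      simp only [← C_add]
      ring_nf
    have h4 : C (|N| - N) ∈ Q := hQ.C_mem (sub_nonneg.2 (le_abs_self N))
    refine ⟨|N| + 1 / 4, by positivity, ?_, ?_⟩
    · convert hQ.add_mem (hQ.add_mem h4 h1) (hQ.sq_mem (X i - C (1 / 2))) using 1
      rw [hk, h2]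
      linear_combination X i * h3
    · convert hQ.add_mem (hQ.add_mem h4 h1) (hQ.sq_mem (X i + C (1 / 2))) using 1
      rw [hk, h2]
      linear_combination (-X i) * h3
  induction a using MvPolynomial.induction_on with
  | C r => exact hQ.bounded_C r
  | add p q hp hq => exact hp.add hQ hq
  | mul_X p i hp => exact hp.mul hQ (hX i)

end IsQuadraticModule

/-- A subsemiring of real polynomials which contains all squares and an element with compact
nonnegativity set contains `N - ∑ Xᵢ²` for some `N`. -/
theorem MvPolynomial.exists_C_sub_sum_sq_mem {τ : Type} [Fintype τ]
    (M : Subsemiring (MvPolynomial τ ℝ)) (hM : ∀ a, a ^ 2 ∈ M) {P : MvPolynomial τ ℝ} (hP : P ∈ M)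
    (hc : IsCompact {z | 0 ≤ eval z P}) : ∃ N : ℝ, C N - ∑ i, X i ^ 2 ∈ M := by
  obtain ⟨N, hN, hNP⟩ : ∃ N : ℝ, 0 ≤ N ∧ ∀ z, 0 ≤ eval z P → 0 < eval z (C N - ∑ i, X i ^ 2) := by
    obtain ⟨N, hN⟩ := hc.bddAbove_image (f := fun z => ∑ i, z i ^ 2) (by fun_prop)
    refine ⟨|N| + 1, by positivity, fun z hz => ?_⟩
    have h1 := hN ⟨z, hz, rfl⟩
    have h2 := le_abs_self N
    simp only [map_sub, eval_C, map_sum, map_pow, eval_X]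
    linarith
  have hQM := IsQuadraticModule.of_subsemiring M hM
  obtain ⟨s, hs, t, ht, hst⟩ := exists_mul_eq_one_add P _ M hM hP hNP
  set g : MvPolynomial τ ℝ := C N - ∑ i, X i ^ 2 with hg
  have hQ := hQM.add_mul hM g
  obtain ⟨m, hm, ⟨a, ha, b, hb, hmt⟩, -⟩ := hQ.bounded_of_C_sub_sum_sq_mem (N := N)
    ⟨0, M.zero_mem, 1, M.one_mem, by simp [hg]⟩ t
  have h1 : C (m + m ^ 2 / 4) - t ∈ M := by
    have h2 : (C (1 / 2) : MvPolynomial τ ℝ) * 2 = 1 := by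
      rw [← map_ofNat C, ← MvPolynomial.C_mul]
      norm_num
    have h3 : (C (m + m ^ 2 / 4) : MvPolynomial τ ℝ) = C m + (C m * C (1 / 2)) ^ 2 := by
      simp only [← MvPolynomial.C_mul, ← C_pow, ← C_add]
      ring_nf
    have h4 : C (m + m ^ 2 / 4) - t = (1 + t) * a + b * (s * g ^ 2) + (C m * C (1 / 2) - t) ^ 2 := by
      rw [h3]
      linear_combination (1 + t) * hmt - b * g * hst + (t * C m) * h2
    rw [h4]
    exact add_mem (add_mem (mul_mem (add_mem M.one_mem ht) ha)
      (mul_mem hb (mul_mem hs (hM g)))) (hM _)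
  generalize m + m ^ 2 / 4 = k at h1
  refine ⟨N * (1 + k), ?_⟩
  have h5 : C (N * (1 + k)) - ∑ i, X i ^ 2 =
      s * g ^ 2 + t * ∑ i, X i ^ 2 + C N * (C k - t) := by
    rw [MvPolynomial.C_mul, C_add, C_1]
    linear_combination (-g) * hst - (1 + t) * hg
  rw [h5]
  exact add_mem (add_mem (mul_mem hs (hM g)) (mul_mem ht (sum_mem fun i _ => hM _)))
    (hQM.C_mul_mem hN h1)

namespace IsQuadraticModule

theorem mul_mem_of_neg_mem {A : Type} [CommRing A] [Invertible (2 : A)] {Q : Set A}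
    (hQ : IsQuadraticModule Q) {x : A} (h1 : x ∈ Q) (h2 : -x ∈ Q) (a : A) : x * a ∈ Q := by
  have h : x * a = (⅟2 * (a + 1)) ^ 2 * x + (⅟2 * (a - 1)) ^ 2 * -x := by
    have h4 : ⅟(2 : A) * 2 = 1 := invOf_mul_self 2
    linear_combination (-(x * a) * (⅟2 * 2 + 1)) * h4
  rw [h]
  exact hQ.add_mem (hQ.sq_mul_mem _ h1) (hQ.sq_mul_mem _ h2)

/-- A proper quadratic module is contained in a proper quadratic module `S` with `S ∪ -S`
everything. -/
theorem exists_total_ge {A : Type} [CommRing A] [Invertible (2 : A)] {Q : Set A}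
    (hQ : IsQuadraticModule Q) (hneg : -1 ∉ Q) :
    ∃ S, Q ⊆ S ∧ IsQuadraticModule S ∧ -1 ∉ S ∧ ∀ a, a ∈ S ∨ -a ∈ S := by
  obtain ⟨S, hQS, hS⟩ := zorn_subset_nonempty {S : Set A | IsQuadraticModule S ∧ -1 ∉ S} (by
    rintro c hc hchain ⟨S₀, hS₀⟩
    refine ⟨⋃₀ c, ⟨⟨⟨S₀, hS₀, (hc hS₀).1.one_mem⟩, ?_, ?_⟩, ?_⟩, fun s hs =>
      Set.subset_sUnion_of_mem hs⟩
    · rintro a b ⟨S₁, h1, ha⟩ ⟨S₂, h2, hb⟩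
      rcases hchain.total h1 h2 with h | h
      · exact ⟨S₂, h2, (hc h2).1.add_mem (h ha) hb⟩
      · exact ⟨S₁, h1, (hc h1).1.add_mem ha (h hb)⟩
    · rintro a q ⟨S₁, h1, hq⟩
      exact ⟨S₁, h1, (hc h1).1.sq_mul_mem a hq⟩
    · rintro ⟨S₁, h1, hq⟩
      exact (hc h1).2 hq) Q ⟨hQ, hneg⟩
  obtain ⟨hSQ, hSneg⟩ := hS.prop
  refine ⟨S, hQS, hSQ, hSneg, ?_⟩
  have hsq : ∀ a : A, a ^ 2 ∈ Subsemiring.sumSq A := fun a => by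
    rw [pow_two]; exact Subsemiring.mem_sumSq.2 (IsSumSq.mul_self a)
  have key : ∀ a ∉ S, ∃ s ∈ S, ∃ t, IsSumSq t ∧ -1 = s + t * a := by
    intro a ha
    by_contra! hcon
    have hle := hS.le_of_ge (y := {x | ∃ q ∈ S, ∃ m ∈ Subsemiring.sumSq A, x = q + m * a})
      ⟨hSQ.add_mul hsq a, fun ⟨q, hq, m, hm, h⟩ => hcon q hq m (Subsemiring.mem_sumSq.1 hm) h⟩
      fun x hx => ⟨x, hx, 0, (Subsemiring.sumSq _).zero_mem, by simp⟩
    exact ha (hle ⟨0, hSQ.zero_mem, 1, (Subsemiring.sumSq _).one_mem, by simp⟩)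
  by_contra! hcon
  obtain ⟨a, ha1, ha2⟩ := hcon
  obtain ⟨s₁, hs₁, t₁, ht₁, h1⟩ := key a ha1
  obtain ⟨s₂, hs₂, t₂, ht₂, h2⟩ := key (-a) ha2
  have ht₁S : t₁ ∈ S := by simpa using hSQ.isSumSq_mul_mem ht₁ hSQ.one_mem
  have ht₂S : t₂ ∈ S := by simpa using hSQ.isSumSq_mul_mem ht₂ hSQ.one_mem
  have hnt₁ : -t₁ ∈ S := by
    have h : -t₁ = t₂ + t₂ * s₁ + t₁ * s₂ := by linear_combination t₂ * h1 + t₁ * h2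
    rw [h]
    exact hSQ.add_mem (hSQ.add_mem ht₂S (hSQ.isSumSq_mul_mem ht₂ hs₁))
      (hSQ.isSumSq_mul_mem ht₁ hs₂)
  refine hSneg ?_
  rw [h1]
  exact hSQ.add_mem hs₁ (hSQ.mul_mem_of_neg_mem ht₁S hnt₁ a)

variable {τ : Type} {Q : Set (MvPolynomial τ ℝ)}

theorem nonneg_of_C_mem (hQ : IsQuadraticModule Q) (hneg : -1 ∉ Q) {r : ℝ} (hr : C r ∈ Q) :
    0 ≤ r := by
  by_contra! h
  refine hneg (hQ.mem_of_C_mul_mem (neg_pos.2 h) ?_)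
  simpa using hr

/-- Elements infinitely small with respect to a quadratic module. -/
def Infinitesimal (Q : Set (MvPolynomial τ ℝ)) (a : MvPolynomial τ ℝ) : Prop :=
  ∀ ε : ℝ, 0 < ε → C ε - a ∈ Q ∧ C ε + a ∈ Q

theorem Infinitesimal.add (hQ : IsQuadraticModule Q) {a b : MvPolynomial τ ℝ}
    (ha : Infinitesimal Q a) (hb : Infinitesimal Q b) : Infinitesimal Q (a + b) := by
  intro ε hε
  obtain ⟨h1, h2⟩ := ha (ε / 2) (by positivity)
  obtain ⟨h3, h4⟩ := hb (ε / 2) (by positivity)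
  have h : C ε = (C (ε / 2) + C (ε / 2) : MvPolynomial τ ℝ) := by rw [← C_add]; ring_nf
  constructor
  · convert hQ.add_mem h1 h3 using 1
    rw [h]; ring
  · convert hQ.add_mem h2 h4 using 1
    rw [h]; ring

theorem Infinitesimal.neg {a : MvPolynomial τ ℝ} (ha : Infinitesimal Q a) :
    Infinitesimal Q (-a) := fun ε hε =>
  ⟨by simpa using (ha ε hε).2, by simpa [sub_eq_add_neg] using (ha ε hε).1⟩

theorem Infinitesimal.C_mul_of_pos (hQ : IsQuadraticModule Q) {a : MvPolynomial τ ℝ}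
    (ha : Infinitesimal Q a) {r : ℝ} (hr : 0 < r) : Infinitesimal Q (C r * a) := by
  intro ε hε
  obtain ⟨h1, h2⟩ := ha (ε / r) (by positivity)
  have h : C ε = (C r * C (ε / r) : MvPolynomial τ ℝ) := by
    rw [← MvPolynomial.C_mul, mul_div_cancel₀ _ hr.ne']
  rw [h, ← mul_sub, ← mul_add]
  exact ⟨hQ.C_mul_mem hr.le h1, hQ.C_mul_mem hr.le h2⟩

theorem infinitesimal_zero (hQ : IsQuadraticModule Q) : Infinitesimal Q 0 := fun ε hε =>
  ⟨by simpa using hQ.C_mem hε.le, by simpa using hQ.C_mem hε.le⟩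

theorem Infinitesimal.C_mul (hQ : IsQuadraticModule Q) {a : MvPolynomial τ ℝ}
    (ha : Infinitesimal Q a) (r : ℝ) : Infinitesimal Q (C r * a) := by
  rcases lt_trichotomy 0 r with hr | rfl | hr
  · exact ha.C_mul_of_pos hQ hr
  · simpa using hQ.infinitesimal_zero
  · simpa using (ha.C_mul_of_pos hQ (neg_pos.2 hr)).neg

theorem Infinitesimal.sq (hQ : IsQuadraticModule Q) {a : MvPolynomial τ ℝ}
    (ha : Infinitesimal Q a) : Infinitesimal Q (a ^ 2) := by
  intro ε hε
  obtain ⟨h1, h2⟩ := ha √ε (Real.sqrt_pos.2 hε)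
  have := hQ.C_sq_sub_sq_mem (Real.sqrt_pos.2 hε) h1 h2
  rw [Real.sq_sqrt hε.le] at this
  exact ⟨this, hQ.add_mem (hQ.C_mem hε.le) (hQ.sq_mem a)⟩

theorem Infinitesimal.mul (hQ : IsQuadraticModule Q) {a b : MvPolynomial τ ℝ}
    (ha : Infinitesimal Q a) (hb : Infinitesimal Q b) : Infinitesimal Q (a * b) := by
  have h : a * b = C (1 / 4) * ((a + b) ^ 2 + -(a + -b) ^ 2) := by
    have : (C (1 / 4) : MvPolynomial τ ℝ) * 4 = 1 := by
      rw [← map_ofNat C, ← MvPolynomial.C_mul]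
      norm_num
    linear_combination (-a * b) * this
  rw [h]
  exact (((ha.add hQ hb).sq hQ).add hQ ((ha.add hQ hb.neg).sq hQ).neg).C_mul hQ _

theorem Infinitesimal.mul_sub_C (hQ : IsQuadraticModule Q) {a b : MvPolynomial τ ℝ} {r s : ℝ}
    (ha : Infinitesimal Q (a - C r)) (hb : Infinitesimal Q (b - C s)) :
    Infinitesimal Q (a * b - C (r * s)) := by
  convert ((ha.mul hQ hb).add hQ (hb.C_mul hQ r)).add hQ (ha.C_mul hQ s) using 1
  rw [MvPolynomial.C_mul]
  ring

theorem exists_infinitesimal_sub_C (hQ : IsQuadraticModule Q) (hneg : -1 ∉ Q)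
    (htot : ∀ a, a ∈ Q ∨ -a ∈ Q) {a : MvPolynomial τ ℝ} (ha : Bounded Q a) :
    ∃ r : ℝ, Infinitesimal Q (a - C r) := by
  obtain ⟨k, hk, h1, h2⟩ := ha
  have hbdd : BddAbove {r | a - C r ∈ Q} := by
    refine ⟨k, fun r hr => ?_⟩
    have := hQ.add_mem h1 hr
    rw [show C k - a + (a - C r) = C (k - r) by rw [C_sub]; ring] at this
    linarith [hQ.nonneg_of_C_mem hneg this]
  have hne : {r | a - C r ∈ Q}.Nonempty := ⟨-k, by simpa [add_comm] using h2⟩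
  refine ⟨sSup {r | a - C r ∈ Q}, fun ε hε => ⟨?_, ?_⟩⟩
  · refine (htot _).resolve_right fun h => ?_
    have := le_csSup hbdd (a := sSup {r | a - C r ∈ Q} + ε) (by
      simp only [Set.mem_ofPred_eq]
      convert h using 1
      rw [C_add]; ring)
    linarith
  · obtain ⟨r, hr, hlt⟩ := exists_lt_of_lt_csSup hne (sub_lt_self (sSup {r | a - C r ∈ Q}) hε)
    convert hQ.add_mem hr (hQ.C_mem (r := r - (sSup {r | a - C r ∈ Q} - ε)) (by linarith)) using 1
    simp only [C_sub]; ring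

/-- A proper Archimedean quadratic module is nonnegative at some point. -/
theorem exists_forall_eval_nonneg (hQ : IsQuadraticModule Q) (hneg : -1 ∉ Q)
    (hb : ∀ a, Bounded Q a) : ∃ z : τ → ℝ, ∀ q ∈ Q, 0 ≤ eval z q := by
  let := invertibleOfNonzero (two_ne_zero (α := ℝ))
  let : Invertible (2 : MvPolynomial τ ℝ) :=
    (Invertible.map (C : ℝ →+* MvPolynomial τ ℝ) 2).copy _ (map_ofNat C 2).symm
  obtain ⟨S, hQS, hS, hSneg, htot⟩ := hQ.exists_total_ge hneg
  have hbS : ∀ a, Bounded S a := fun a =>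
    let ⟨k, hk, h1, h2⟩ := hb a
    ⟨k, hk, hQS h1, hQS h2⟩
  choose z hz using fun i => hS.exists_infinitesimal_sub_C hSneg htot (hbS (X i))
  have key : ∀ p, Infinitesimal S (p - C (eval z p)) := by
    intro p
    induction p using MvPolynomial.induction_on with
    | C r => simpa using hS.infinitesimal_zero
    | add p q hp hq =>
      convert hp.add hS hq using 1
      rw [map_add, C_add]; ring
    | mul_X p i hp =>
      rw [map_mul, eval_X]
      exact hp.mul_sub_C hS (hz i)
  refine ⟨z, fun q hq => ?_⟩
  by_contra! h
  have h1 := hS.add_mem (hQS hq) (key q (-eval z q / 2) (by linarith)).1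
  rw [show q + (C (-eval z q / 2) - (q - C (eval z q))) = C (eval z q / 2) by
    rw [add_sub_assoc', add_sub_sub_cancel, ← C_add]; ring_nf] at h1
  linarith [hS.nonneg_of_C_mem hSneg h1]

theorem add_C_sub_mem (hQ : IsQuadraticModule Q) {f s t : MvPolynomial τ ℝ} (ht : IsSumSq t)
    (hs : s ∈ Q) (hst : t * f = 1 + s) {k : ℝ} (hk : 0 < k) (h1 : C (2 * k) - t ∈ Q)
    (h2 : C (2 * k - 1) - t ^ 2 * f ∈ Q) {r : ℝ} (hr : 0 ≤ r) (hf : f + C r ∈ Q) :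
    f + C (r - 1 / k ^ 2) ∈ Q := by
  have htQ : t ∈ Q := by simpa using hQ.isSumSq_mul_mem ht hQ.one_mem
  have h3 : t * (C (2 * k) - t) ∈ Q := by
    refine hQ.mem_of_C_mul_mem (r := 2 * k) (by positivity) ?_
    convert hQ.add_mem (hQ.sq_mul_mem (C (2 * k) - t) htQ) (hQ.sq_mul_mem t h1) using 1
    ring
  refine hQ.mem_of_C_mul_mem (r := k ^ 2) (by positivity) ?_
  have h4 : C (k ^ 2) * (f + C (r - 1 / k ^ 2)) = (C k - t) ^ 2 * (f + C r) + C (2 * k) * s +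
      C r * (t * (C (2 * k) - t)) + (C (2 * k - 1) - t ^ 2 * f) := by
    have h5 : (C (k ^ 2) * C (1 / k ^ 2) : MvPolynomial τ ℝ) = 1 := by
      rw [← MvPolynomial.C_mul, mul_one_div_cancel (by positivity), C_1]
    rw [map_sub C r, mul_add, mul_sub, h5]
    simp only [C_sub, MvPolynomial.C_mul, C_pow, C_1, map_ofNat]
    linear_combination 2 * C k * hst
  rw [h4]
  exact hQ.add_mem (hQ.add_mem (hQ.add_mem (hQ.sq_mul_mem _ hf)
    (hQ.C_mul_mem (by positivity) hs)) (hQ.C_mul_mem hr h3)) h2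

theorem Bounded.exists_forall_ge (hQ : IsQuadraticModule Q) {a : MvPolynomial τ ℝ}
    (ha : Bounded Q a) : ∃ k : ℝ, ∀ l, k ≤ l → C l - a ∈ Q := by
  obtain ⟨k, -, h, -⟩ := ha
  refine ⟨k, fun l hl => ?_⟩
  convert hQ.add_mem h (hQ.C_mem (sub_nonneg.2 hl)) using 1
  rw [C_sub]; ring

/-- **Putinar's Positivstellensatz** for Archimedean quadratic modules. -/
theorem mem_of_forall_eval_pos (hQ : IsQuadraticModule Q) (hb : ∀ a, Bounded Q a)
    {f : MvPolynomial τ ℝ} (hf : ∀ z : τ → ℝ, (∀ q ∈ Q, 0 ≤ eval z q) → 0 < eval z f) :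
    f ∈ Q := by
  have hsq : ∀ a, a ^ 2 ∈ Subsemiring.sumSq (MvPolynomial τ ℝ) := fun a => by
    rw [pow_two]; exact Subsemiring.mem_sumSq.2 (IsSumSq.mul_self a)
  have hQQ : Q ⊆ {x | ∃ q ∈ Q, ∃ m ∈ Subsemiring.sumSq (MvPolynomial τ ℝ), x = q + m * -f} :=
    fun x hx => ⟨x, hx, 0, (Subsemiring.sumSq _).zero_mem, by simp⟩
  obtain ⟨s, hs, t, ht, hst⟩ : ∃ s ∈ Q, ∃ t, IsSumSq t ∧ t * f = 1 + s := by
    by_contra! hcon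
    obtain ⟨z, hz⟩ := (hQ.add_mul hsq (-f)).exists_forall_eval_nonneg
      (fun ⟨q, hq, m, hm, h⟩ => hcon q hq m (Subsemiring.mem_sumSq.1 hm)
        (by linear_combination h))
      fun a => let ⟨k, hk, h1, h2⟩ := hb a
        ⟨k, hk, hQQ h1, hQQ h2⟩
    have h1 := hf z fun q hq => hz q (hQQ hq)
    have h2 := hz (-f) ⟨0, hQ.zero_mem, 1, (Subsemiring.sumSq _).one_mem, by simp⟩
    rw [map_neg] at h2
    linarith
  obtain ⟨k₁, hk₁⟩ := (hb t).exists_forall_ge hQ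
  obtain ⟨k₂, hk₂⟩ := (hb (t ^ 2 * f)).exists_forall_ge hQ
  set k := |k₁| + |k₂| + 1
  have hk : 0 < k := by positivity
  obtain ⟨r₀, -, -, hr₀⟩ := hb f
  have key : ∀ n : ℕ, f ∈ Q ∨ f + C (r₀ - n * (1 / k ^ 2)) ∈ Q := by
    intro n
    induction n with
    | zero => right; simpa [add_comm] using hr₀
    | succ n ih =>
      refine ih.elim Or.inl fun h => ?_
      rcases le_total 0 (r₀ - n * (1 / k ^ 2)) with hr | hr
      · right
        convert hQ.add_C_sub_mem ht hs hst hk (hk₁ _ ?_) (hk₂ _ ?_) hr h using 3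
        · push_cast; ring
        · linarith [le_abs_self k₁, abs_nonneg k₁, abs_nonneg k₂]
        · linarith [le_abs_self k₂, abs_nonneg k₁, abs_nonneg k₂]
      · left
        convert hQ.add_mem h (hQ.C_mem (neg_nonneg.2 hr)) using 1
        rw [C_neg]; ring
  obtain ⟨n, hn⟩ := exists_nat_gt (r₀ * k ^ 2)
  refine (key n).elim id fun h => ?_
  have hneg : 0 ≤ -(r₀ - n * (1 / k ^ 2)) := by
    rw [neg_nonneg, sub_nonpos, mul_one_div, le_div_iff₀ (by positivity)]
    exact hn.le
  convert hQ.add_mem h (hQ.C_mem hneg) using 1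
  rw [C_neg]; ring

end IsQuadraticModule

theorem isSumOfSquares_iff_isSumSq {σ : Type} {q : MvPolynomial σ ℝ} :
    IsSumOfSquares q ↔ IsSumSq q := by
  constructor
  · rintro ⟨r, h, rfl⟩
    exact IsSumSq.sum fun i _ => by rw [pow_two]; exact IsSumSq.mul_self _
  · intro hq
    induction hq using IsSumSq.rec' with
    | zero => exact ⟨0, Fin.elim0, by simp⟩
    | sq_add hx _ ih =>
      obtain ⟨a, rfl⟩ := hx
      obtain ⟨r, h, rfl⟩ := ih
      exact ⟨r + 1, Fin.cons a h, by simp [Fin.sum_univ_succ, pow_two]⟩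

theorem IsSumSq.eval_nonneg {σ : Type} {q : MvPolynomial σ ℝ} (hq : IsSumSq q) (z : σ → ℝ) :
    0 ≤ eval z q := by
  induction hq using IsSumSq.rec' with
  | zero => simp
  | sq_add hx _ ih =>
    obtain ⟨a, rfl⟩ := hx
    rw [map_add, map_mul]
    exact add_nonneg (mul_self_nonneg _) ih

section JointQuadraticModule

variable {n p s₁ s₃ : ℕ} {ht : Fin s₃ → MvPolynomial (Fin n) ℝ}
  {hh : Fin s₁ → MvPolynomial (Fin p) ℝ}

theorem isQuadraticModule_memJointQM (ht : Fin s₃ → MvPolynomial (Fin n) ℝ)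
    (hh : Fin s₁ → MvPolynomial (Fin p) ℝ) :
    IsQuadraticModule {q | MemJointQM ht hh q} where
  one_mem := by
    refine ⟨1, 0, 0, ?_, ?_, ?_, by simp⟩
    · exact isSumOfSquares_iff_isSumSq.2 (by simp)
    all_goals exact fun _ => isSumOfSquares_iff_isSumSq.2 IsSumSq.zero
  add_mem := by
    rintro _ _ ⟨σ₀, σ, τ, h₀, hσ, hτ, rfl⟩ ⟨σ₀', σ', τ', h₀', hσ', hτ', rfl⟩
    simp only [isSumOfSquares_iff_isSumSq] at *
    refine ⟨σ₀ + σ₀', σ + σ', τ + τ', ?_, fun k => ?_, fun k => ?_, ?_⟩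
    · exact isSumOfSquares_iff_isSumSq.2 (h₀.add h₀')
    · exact isSumOfSquares_iff_isSumSq.2 ((hσ k).add (hσ' k))
    · exact isSumOfSquares_iff_isSumSq.2 ((hτ k).add (hτ' k))
    · simp only [Pi.add_apply, add_mul, Finset.sum_add_distrib]
      ring
  sq_mul_mem := by
    rintro a _ ⟨σ₀, σ, τ, h₀, hσ, hτ, rfl⟩
    have ha : IsSumSq (a ^ 2) := by rw [pow_two]; exact IsSumSq.mul_self a
    simp only [isSumOfSquares_iff_isSumSq] at *
    refine ⟨a ^ 2 * σ₀, fun k => a ^ 2 * σ k, fun k => a ^ 2 * τ k, ?_, fun k => ?_, fun k => ?_, ?_⟩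
    · exact isSumOfSquares_iff_isSumSq.2 (ha.mul h₀)
    · exact isSumOfSquares_iff_isSumSq.2 (ha.mul (hσ k))
    · exact isSumOfSquares_iff_isSumSq.2 (ha.mul (hτ k))
    · simp only [mul_add, Finset.mul_sum, mul_assoc]

theorem memJointQM_inl (k : Fin s₃) : MemJointQM ht hh (rename Sum.inl (ht k)) := by
  refine ⟨0, Pi.single k 1, 0, ?_, fun j => ?_, fun j => ?_, ?_⟩
  · exact isSumOfSquares_iff_isSumSq.2 IsSumSq.zero
  · rw [isSumOfSquares_iff_isSumSq]
    obtain rfl | h := eq_or_ne j k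
    · simp
    · simp [h]
  · exact isSumOfSquares_iff_isSumSq.2 IsSumSq.zero
  · simp [Pi.single_apply, ite_mul]

theorem memJointQM_inr (k : Fin s₁) : MemJointQM ht hh (rename Sum.inr (hh k)) := by
  refine ⟨0, 0, Pi.single k 1, ?_, fun j => ?_, fun j => ?_, ?_⟩
  · exact isSumOfSquares_iff_isSumSq.2 IsSumSq.zero
  · exact isSumOfSquares_iff_isSumSq.2 IsSumSq.zero
  · rw [isSumOfSquares_iff_isSumSq]
    obtain rfl | h := eq_or_ne j k
    · simp
    · simp [h]
  · simp [Pi.single_apply, ite_mul]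

theorem MemTruncJointQM.memJointQM {d : ℕ} {g : MvPolynomial (Fin n ⊕ Fin p) ℝ}
    (hg : MemTruncJointQM ht hh d g) : MemJointQM ht hh g := by
  obtain ⟨σ₀, σ, τ, h₀, hσ, hτ, -, -, -, h⟩ := hg
  exact ⟨σ₀, σ, τ, h₀, hσ, hτ, h⟩

theorem MemJointQM.eventually_memTruncJointQM {g : MvPolynomial (Fin n ⊕ Fin p) ℝ}
    (hg : MemJointQM ht hh g) : ∀ᶠ d in atTop, MemTruncJointQM ht hh d g := by
  obtain ⟨σ₀, σ, τ, h₀, hσ, hτ, h⟩ := hg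
  have hle (m : ℕ) : ∀ᶠ d in atTop, m ≤ 2 * d :=
    (eventually_ge_atTop m).mono fun d hd => by omega
  filter_upwards [hle σ₀.totalDegree,
    eventually_all.2 fun k => hle (σ k * rename Sum.inl (ht k)).totalDegree,
    eventually_all.2 fun k => hle (τ k * rename Sum.inr (hh k)).totalDegree] with d h1 h2 h3
  exact ⟨σ₀, σ, τ, h₀, hσ, hτ, h1, h2, h3, h⟩

theorem MemJointQM.eval_nonneg {g : MvPolynomial (Fin n ⊕ Fin p) ℝ} (hg : MemJointQM ht hh g)
    {x : Fin n → ℝ} {u : Fin p → ℝ} (hx : ∀ k, 0 ≤ eval x (ht k))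
    (hu : ∀ k, 0 ≤ eval u (hh k)) : 0 ≤ eval (Sum.elim x u) g := by
  obtain ⟨σ₀, σ, τ, h₀, hσ, hτ, rfl⟩ := hg
  simp only [isSumOfSquares_iff_isSumSq] at h₀ hσ hτ
  simp only [map_add, map_sum, map_mul, eval_rename, Sum.elim_comp_inl, Sum.elim_comp_inr]
  have h1 := h₀.eval_nonneg (Sum.elim x u)
  have h2 : 0 ≤ ∑ k, eval (Sum.elim x u) (σ k) * eval x (ht k) :=
    Finset.sum_nonneg fun k _ => mul_nonneg ((hσ k).eval_nonneg _) (hx k)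
  have h3 : 0 ≤ ∑ k, eval (Sum.elim x u) (τ k) * eval u (hh k) :=
    Finset.sum_nonneg fun k _ => mul_nonneg ((hτ k).eval_nonneg _) (hu k)
  linarith

/-- An Archimedean joint quadratic module contains every polynomial that is positive on the
product of the two semialgebraic sets. -/
theorem memJointQM_of_forall_eval_pos {P : MvPolynomial (Fin n ⊕ Fin p) ℝ}
    (hP : MemJointQM ht hh P) (hPc : IsCompact {z : (Fin n ⊕ Fin p) → ℝ | 0 ≤ eval z P})
    {g : MvPolynomial (Fin n ⊕ Fin p) ℝ}
    (hg : ∀ x u, (∀ k, 0 ≤ eval x (ht k)) → (∀ k, 0 ≤ eval u (hh k)) →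
      0 < eval (Sum.elim x u) g) : MemJointQM ht hh g := by
  have hQ := isQuadraticModule_memJointQM ht hh
  have hsq : ∀ a, a ^ 2 ∈ Subsemiring.sumSq (MvPolynomial (Fin n ⊕ Fin p) ℝ) := fun a => by
    rw [pow_two]; exact Subsemiring.mem_sumSq.2 (IsSumSq.mul_self a)
  obtain ⟨N, hN⟩ := MvPolynomial.exists_C_sub_sum_sq_mem ((Subsemiring.sumSq _).addMul hsq P)
    (fun a => Subsemiring.le_addMul _ hsq P (hsq a)) (Subsemiring.self_mem_addMul _ hsq P) hPc
  have hNQ : C N - ∑ i, X i ^ 2 ∈ {q | MemJointQM ht hh q} := by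
    obtain ⟨q, hq, m, hm, h⟩ := Subsemiring.mem_addMul.1 hN
    rw [h]
    refine hQ.add_mem ?_ (hQ.isSumSq_mul_mem (Subsemiring.mem_sumSq.1 hm) hP)
    simpa using hQ.isSumSq_mul_mem (Subsemiring.mem_sumSq.1 hq) hQ.one_mem
  refine hQ.mem_of_forall_eval_pos (hQ.bounded_of_C_sub_sum_sq_mem hNQ) fun z hz => ?_
  rw [← Sum.elim_comp_inl_inr z]
  refine hg _ _ (fun k => ?_) fun k => ?_
  · simpa [eval_rename] using hz _ (memJointQM_inl k)
  · simpa [eval_rename] using hz _ (memJointQM_inr k)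

end JointQuadraticModule

/-- The Stone–Weierstrass theorem for polynomials on a compact subset of `ℝⁿ`. -/
theorem MvPolynomial.exists_forall_abs_eval_sub_lt {n : ℕ} {K : Set (Fin n → ℝ)}
    (hK : IsCompact K) {g : (Fin n → ℝ) → ℝ} (hg : Continuous g) {ε : ℝ} (hε : 0 < ε) :
    ∃ q : MvPolynomial (Fin n) ℝ, ∀ x ∈ K, |eval x q - g x| < ε := by
  let Φ : MvPolynomial (Fin n) ℝ →ₐ[ℝ] C(Fin n → ℝ, ℝ) :=
    aeval fun i => ⟨fun x => x i, continuous_apply i⟩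
  have hΦ (q : MvPolynomial (Fin n) ℝ) (x : Fin n → ℝ) : Φ q x = eval x q := by
    induction q using MvPolynomial.induction_on with
    | C r => simp [Φ]
    | add p q hp hq => simp [hp, hq]
    | mul_X p i hp => simp [hp, Φ]
  have hsep : Φ.range.SeparatesPoints := by
    intro x y hxy
    obtain ⟨i, hi⟩ := Function.ne_iff.1 hxy
    exact ⟨_, ⟨Φ (X i), ⟨X i, rfl⟩, rfl⟩, by simpa [hΦ] using hi⟩
  obtain ⟨_, ⟨q, rfl⟩, hq⟩ :=
    ContinuousMap.exists_mem_subalgebra_near_continuous_of_isCompact_of_separatesPoints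
      hsep ⟨g, hg⟩ hK hε
  exact ⟨q, fun x hx => by simpa [hΦ] using hq x hx⟩

/-- (L¹ convergence of the "joint+marginal" upper
approximations, Lasserre.) Every feasible `q ∈ 𝒫_d` dominates the optimal value
function `F(x) = sup_{u ∈ U} f(x, u)` on `X`, and any near-optimal sequence
`q_d ∈ 𝒫_d` (with `∫_X q_d dφ ≤ ρ_d + 1/d` for large `d`) converges to `F` in
`L¹(X, φ)`. -/
theorem joint_marginal_L1_convergence {n p s₁ s₃ : ℕ}
    (ht : Fin s₃ → MvPolynomial (Fin n) ℝ) (hh : Fin s₁ → MvPolynomial (Fin p) ℝ)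
    (X : Set (Fin n → ℝ)) (hXdef : X = {x | ∀ k, 0 ≤ eval x (ht k)})
    (hXne : X.Nonempty) (hXc : IsCompact X)
    (U : Set (Fin p → ℝ)) (hUdef : U = {u | ∀ k, 0 ≤ eval u (hh k)})
    (hUne : U.Nonempty) (hUc : IsCompact U)
    (hArch : ∃ P : MvPolynomial (Fin n ⊕ Fin p) ℝ, MemJointQM ht hh P ∧
      IsCompact {z : (Fin n ⊕ Fin p) → ℝ | 0 ≤ eval z P})
    (φ : Measure (Fin n → ℝ)) [IsFiniteMeasure φ]
    (hφsupp : φ Xᶜ = 0)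
    (hφpos : ∀ O : Set (Fin n → ℝ), IsOpen O → O.Nonempty → O ⊆ X → 0 < φ O)
    (f : MvPolynomial (Fin n ⊕ Fin p) ℝ)
    (F : (Fin n → ℝ) → ℝ)
    (hF : ∀ x, F x = sSup ((fun u => eval (Sum.elim x u) f) '' U))
    (ρ : ℕ → ℝ)
    (hρ : ∀ d, ρ d = sInf ((fun q => ∫ x in X, eval x q ∂φ) '' JMFeasible ht hh f d)) :
    (∀ d : ℕ, ∀ q ∈ JMFeasible ht hh f d, ∀ x ∈ X, F x ≤ eval x q) ∧
    ∀ q : ℕ → MvPolynomial (Fin n) ℝ,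
      (∀ᶠ d in atTop, q d ∈ JMFeasible ht hh f d ∧
        ∫ x in X, eval x (q d) ∂φ ≤ ρ d + 1 / (d : ℝ)) →
      (∀ᶠ d in atTop,
        ∫ x in X, |eval x (q d) - F x| ∂φ = ∫ x in X, (eval x (q d) - F x) ∂φ) ∧
      Tendsto (fun d => ∫ x in X, |eval x (q d) - F x| ∂φ) atTop (nhds 0) := by
  have hmem {x : Fin n → ℝ} : x ∈ X ↔ ∀ k, 0 ≤ eval x (ht k) := by rw [hXdef]; rfl
  have hmemU {u : Fin p → ℝ} : u ∈ U ↔ ∀ k, 0 ≤ eval u (hh k) := by rw [hUdef]; rfl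
  have hfc : Continuous fun z : (Fin n → ℝ) × (Fin p → ℝ) => eval (Sum.elim z.1 z.2) f := by
    refine (MvPolynomial.continuous_eval f).comp (continuous_pi ?_)
    rintro (i | i)
    · exact (continuous_apply i).comp continuous_fst
    · exact (continuous_apply i).comp continuous_snd
  have hFc : Continuous F := by
    have := hUc.continuous_sSup (f := fun x u => eval (Sum.elim x u) f) hfc
    exact this.congr fun x => (hF x).symm
  have hle (x : Fin n → ℝ) {u : Fin p → ℝ} (hu : u ∈ U) : eval (Sum.elim x u) f ≤ F x := by
    rw [hF]
    have hc : Continuous fun u : Fin p → ℝ => eval (Sum.elim x u) f := by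
      refine (MvPolynomial.continuous_eval f).comp (continuous_pi ?_)
      rintro (i | i)
      · exact continuous_const
      · exact continuous_apply i
    exact le_csSup (hUc.bddAbove_image hc.continuousOn) ⟨u, hu, rfl⟩
  have heval (q : MvPolynomial (Fin n) ℝ) (x : Fin n → ℝ) (u : Fin p → ℝ) :
      eval (Sum.elim x u) (rename Sum.inl q - f) = eval x q - eval (Sum.elim x u) f := by
    rw [map_sub, eval_rename, Sum.elim_comp_inl]
  have hdom (d : ℕ) (q) (hq : q ∈ JMFeasible ht hh f d) (x) (hx : x ∈ X) : F x ≤ eval x q := by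
    rw [hF]
    refine csSup_le (hUne.image _) ?_
    rintro _ ⟨u, hu, rfl⟩
    have := hq.2.memJointQM.eval_nonneg (hmem.1 hx) (hmemU.1 hu)
    rw [heval] at this
    exact sub_nonneg.1 this
  have hFi : IntegrableOn F X φ := hFc.continuousOn.integrableOn_compact hXc
  have hqi (q : MvPolynomial (Fin n) ℝ) : IntegrableOn (fun x => eval x q) X φ :=
    (MvPolynomial.continuous_eval q).continuousOn.integrableOn_compact hXc
  have habs (d : ℕ) (q) (hq : q ∈ JMFeasible ht hh f d) :
      ∫ x in X, |eval x q - F x| ∂φ = ∫ x in X, (eval x q - F x) ∂φ :=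
    setIntegral_congr_fun hXc.measurableSet fun x hx =>
      abs_of_nonneg (sub_nonneg.2 (hdom d q hq x hx))
  have hbdd (d : ℕ) : BddBelow ((fun q => ∫ x in X, eval x q ∂φ) '' JMFeasible ht hh f d) := by
    refine ⟨∫ x in X, F x ∂φ, ?_⟩
    rintro _ ⟨q, hq, rfl⟩
    exact setIntegral_mono_on hFi (hqi q) hXc.measurableSet (hdom d q hq)
  have hρle {δ : ℝ} (hδ : 0 < δ) :
      ∀ᶠ d in atTop, ρ d ≤ ∫ x in X, F x ∂φ + 3 * δ * φ.real X := by
    obtain ⟨q, hq⟩ := MvPolynomial.exists_forall_abs_eval_sub_lt hXc hFc hδ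
    obtain ⟨P, hP, hPc⟩ := hArch
    have hqm : MemJointQM ht hh (rename Sum.inl (q + C (2 * δ)) - f) := by
      refine memJointQM_of_forall_eval_pos hP hPc fun x u hx hu => ?_
      rw [heval, map_add, eval_C]
      linarith [(abs_lt.1 (hq x (hmem.2 hx))).1, hle x (hmemU.2 hu)]
    filter_upwards [hqm.eventually_memTruncJointQM, eventually_ge_atTop (q + C (2 * δ)).totalDegree]
      with d h1 h2
    rw [hρ]
    calc sInf _ ≤ ∫ x in X, eval x (q + C (2 * δ)) ∂φ := csInf_le (hbdd d) ⟨_, ⟨h2, h1⟩, rfl⟩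
      _ ≤ ∫ x in X, (F x + 3 * δ) ∂φ := by
        refine setIntegral_mono_on (hqi _) (hFi.add (integrable_const _)) hXc.measurableSet ?_
        intro x hx
        rw [map_add, eval_C]
        linarith [(abs_lt.1 (hq x hx)).2]
      _ = ∫ x in X, F x ∂φ + 3 * δ * φ.real X := by
        rw [integral_add hFi (integrable_const _), setIntegral_const, smul_eq_mul]
        ring
  refine ⟨hdom, fun q hq => ⟨hq.mono fun d h => habs d _ h.1, ?_⟩⟩
  refine Metric.tendsto_nhds.2 fun ε hε => ?_
  have hv : 0 ≤ φ.real X := measureReal_nonneg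
  set δ := ε / (6 * (φ.real X + 1)) with hδdef
  have hδ : 0 < δ := by positivity
  have hδε : 6 * δ * (φ.real X + 1) = ε := by rw [hδdef]; field_simp
  filter_upwards [hq, hρle hδ, tendsto_one_div_atTop_nhds_zero_nat.eventually_lt_const
    (half_pos hε)] with d h1 h2 h3
  rw [Real.dist_eq, sub_zero, abs_of_nonneg (integral_nonneg fun x => abs_nonneg _),
    habs d _ h1.1, integral_sub (hqi _) hFi]
  linarith [h1.2]
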